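/- arXiv:1807.07731 — 3 statements merged into one kernel-verified Lean document; each statement's English description precedes it below -/
import Mathlib

section
/- Let 0 < α < 1 and r > 0. Then E_α(r e^{iαπ/2} t^α) − (1/α) exp(i r^{1/α} t) → 0 as t → ∞. -/
open Filter Real

/-- The two-parameter Mittag-Leffler function `E_{α,β}(z) = ∑_{k=0}^∞ z^k / Γ(αk + β)`. -/
noncomputable def mittagLeffler (α β : ℝ) (z : ℂ) : ℂ :=
  ∑' k : ℕ, z ^ k / Complex.Gamma (α * k + β)

open MeasureTheory Set Topology

theorem rpow_mul_exp_neg_le_Gamma {s M : ℝ} (hs : 0 ≤ s) (hM : 0 < M) :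
    M ^ s * exp (-M) ≤ Gamma (s + 1) := by
  have hint : IntegrableOn (fun x : ℝ => exp (-x) * x ^ (s + 1 - 1)) (Ioi 0) :=
    Real.GammaIntegral_convergent (by linarith)
  rw [Real.Gamma_eq_integral (by linarith)]
  calc M ^ s * exp (-M) = ∫ x in Ioi M, M ^ s * exp (-x) := by
        rw [integral_const_mul, integral_exp_neg_Ioi]
    _ ≤ ∫ x in Ioi M, exp (-x) * x ^ (s + 1 - 1) := by
        refine setIntegral_mono_on ((integrableOn_exp_neg_Ioi M).const_mul _)
          (hint.mono_set (Ioi_subset_Ioi hM.le)) measurableSet_Ioi fun x hx => ?_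
        rw [add_sub_cancel_right, mul_comm]
        gcongr
        exact hx.le
    _ ≤ _ := by
        refine setIntegral_mono_set hint ?_ (Ioi_subset_Ioi hM.le).eventuallyLE
        filter_upwards [ae_restrict_mem measurableSet_Ioi] with x hx
        have : (0 : ℝ) < x := hx
        positivity

theorem Gamma_nat_mul_add_one {α : ℝ} (k : ℕ) :
    Complex.Gamma (α * k + (1 : ℝ)) = (Gamma (α * k + 1) : ℝ) := by
  rw [← Complex.Gamma_ofReal]
  push_cast
  rfl

theorem exists_pow_div_Gamma_le {α : ℝ} (hα : 0 < α) {x : ℝ} (hx : 0 < x) :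
    ∃ C : ℝ, ∀ (k : ℕ) (z : ℂ), ‖z‖ ≤ x →
      ‖z ^ k / Complex.Gamma (α * k + (1 : ℝ))‖ ≤ C * (1 / 2) ^ k := by
  set M : ℝ := (2 * x) ^ (1 / α)
  have hM : 0 < M := by positivity
  refine ⟨exp M, fun k z hz => ?_⟩
  have h1 : M ^ (α * k) = (2 * x) ^ k := by
    rw [← rpow_mul (by positivity), ← rpow_natCast]
    congr 1
    field_simp
  have h2 := rpow_mul_exp_neg_le_Gamma (s := α * k) (by positivity) hM
  rw [h1] at h2
  have h3 : 0 < Gamma (α * k + 1) := Gamma_pos_of_pos (by positivity)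
  rw [Gamma_nat_mul_add_one, norm_div, norm_pow, Complex.norm_real, norm_of_nonneg h3.le,
    div_le_iff₀ h3]
  calc ‖z‖ ^ k ≤ x ^ k := by gcongr
    _ = exp M * (1 / 2) ^ k * ((2 * x) ^ k * exp (-M)) := by
        rw [mul_comm ((2 * x) ^ k), mul_mul_mul_comm, ← exp_add, ← mul_pow]
        simp
    _ ≤ _ := by gcongr

theorem continuous_mittagLeffler {α : ℝ} (hα : 0 < α) : Continuous (mittagLeffler α 1) := by
  refine continuous_iff_continuousAt.2 fun z => ?_
  obtain ⟨C, hC⟩ := exists_pow_div_Gamma_le hα (x := ‖z‖ + 1) (by positivity)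
  have h : ContinuousOn (mittagLeffler α 1) (Metric.closedBall 0 (‖z‖ + 1)) :=
    continuousOn_tsum (fun k => by fun_prop) (summable_geometric_two.mul_left C)
      fun k w hw => hC k w (by simpa using hw)
  refine h.continuousAt (Metric.closedBall_mem_nhds_of_mem ?_)
  simp

theorem integrableOn_rpow_mul_cexp {a : ℝ} (ha : -1 < a) {p : ℂ} (hp : 0 < p.re) :
    IntegrableOn (fun t : ℝ => ((t ^ a : ℝ) : ℂ) * Complex.exp (-p * t)) (Ioi 0) := by
  have h := integrableOn_rpow_mul_exp_neg_mul_rpow ha one_pos hp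
  refine Integrable.mono' h (by fun_prop) ?_
  filter_upwards [ae_restrict_mem measurableSet_Ioi] with t ht
  have ht' : (0 : ℝ) < t := ht
  rw [norm_mul, Complex.norm_exp, Complex.norm_real, norm_of_nonneg (by positivity)]
  simp

theorem differentiableAt_integral_rpow_mul_cexp {a : ℝ} (ha : -1 < a) {p : ℂ} (hp : 0 < p.re) :
    DifferentiableAt ℂ
      (fun p : ℂ => ∫ t in Ioi (0 : ℝ), ((t ^ a : ℝ) : ℂ) * Complex.exp (-p * t)) p := by
  have hq : ∀ q ∈ {q : ℂ | p.re / 2 < q.re}, 0 < q.re := fun q hq => by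
    have : p.re / 2 < q.re := hq
    linarith
  refine (hasDerivAt_integral_of_dominated_loc_of_deriv_le
    (μ := volume.restrict (Ioi 0))
    (F := fun q (t : ℝ) => ((t ^ a : ℝ) : ℂ) * Complex.exp (-q * t))
    (F' := fun q (t : ℝ) => ((t ^ a : ℝ) : ℂ) * (Complex.exp (-q * t) * (-t)))
    (bound := fun t => t ^ (a + 1) * exp (-(p.re / 2) * t ^ (1 : ℝ)))
    (s := {q : ℂ | p.re / 2 < q.re})
    ((isOpen_lt continuous_const Complex.continuous_re).mem_nhds (by
      show p.re / 2 < p.re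
      linarith))
    (.of_forall fun q => by fun_prop) (integrableOn_rpow_mul_cexp ha hp) (by fun_prop) ?_
    (integrableOn_rpow_mul_exp_neg_mul_rpow (by linarith) one_pos (by linarith))
    ?_).2.differentiableAt
  · filter_upwards [ae_restrict_mem measurableSet_Ioi] with t ht q hq
    have ht' : (0 : ℝ) < t := ht
    have hq' : p.re / 2 < q.re := hq
    rw [norm_mul, norm_mul, Complex.norm_exp, Complex.norm_real, norm_of_nonneg (by positivity),
      norm_neg, Complex.norm_real, norm_of_nonneg ht'.le, rpow_add_one ht'.ne', rpow_one, mul_assoc,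
      mul_comm t]
    gcongr
    simp
    gcongr
  · refine .of_forall fun t q hq => ?_
    have h : HasDerivAt (fun q : ℂ => -q * t) (-t) q := by
      simpa using ((hasDerivAt_id q).neg.mul_const (t : ℂ))
    exact (h.cexp.const_mul _)

theorem integral_rpow_mul_cexp {a : ℝ} (ha : -1 < a) {p : ℂ} (hp : 0 < p.re) :
    ∫ t in Ioi (0 : ℝ), ((t ^ a : ℝ) : ℂ) * Complex.exp (-p * t) =
      (p ^ ((a : ℂ) + 1))⁻¹ * Complex.Gamma (a + 1) := by
  have hopen : IsOpen {q : ℂ | 0 < q.re} := isOpen_lt continuous_const Complex.continuous_re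
  have h1 : AnalyticOnNhd ℂ (fun p : ℂ => ∫ t in Ioi (0 : ℝ), ((t ^ a : ℝ) : ℂ) *
      Complex.exp (-p * t)) {q : ℂ | 0 < q.re} :=
    DifferentiableOn.analyticOnNhd (fun q hq =>
      (differentiableAt_integral_rpow_mul_cexp ha hq).differentiableWithinAt) hopen
  have h2 : AnalyticOnNhd ℂ (fun p : ℂ => (p ^ ((a : ℂ) + 1))⁻¹ * Complex.Gamma (a + 1))
      {q : ℂ | 0 < q.re} := by
    refine DifferentiableOn.analyticOnNhd (fun q hq => ?_) hopen
    have hq0 : q ≠ 0 := by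
      rintro rfl
      simp at hq
    exact (((differentiableAt_id.cpow_const (.inl hq)).inv
      (by simp [Complex.cpow_eq_zero_iff, hq0])).mul_const _).differentiableWithinAt
  refine h1.eqOn_of_preconnected_of_frequently_eq h2 (convex_halfSpace_re_gt 0).isPreconnected
    (z₀ := 1) (by simp) ?_ hp
  have hreal : ∀ x : ℝ, 0 < x → ∫ t in Ioi (0 : ℝ), ((t ^ a : ℝ) : ℂ) * Complex.exp (-(x : ℂ) * t) =
      ((x : ℂ) ^ ((a : ℂ) + 1))⁻¹ * Complex.Gamma (a + 1) := by
    intro x hx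
    have := Complex.integral_cpow_mul_exp_neg_mul_Ioi (a := (a : ℂ) + 1) (r := x)
      (by simp; linarith) hx
    rw [one_div, Complex.inv_cpow _ _ (by
      rw [Complex.arg_ofReal_of_nonneg hx.le]; exact pi_pos.ne)] at this
    rw [← this]
    refine setIntegral_congr_fun measurableSet_Ioi fun t ht => ?_
    have ht' : (0 : ℝ) < t := ht
    simp only [add_sub_cancel_right, Complex.ofReal_cpow ht'.le, neg_mul]
  have htend : Tendsto (fun n : ℕ => ((1 + 1 / ((n : ℝ) + 1) : ℝ) : ℂ)) atTop (𝓝[≠] 1) := by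
    refine tendsto_nhdsWithin_iff.2 ⟨?_, .of_forall fun n => ?_⟩
    · have := (Complex.continuous_ofReal.tendsto _).comp
        (tendsto_one_div_add_atTop_nhds_zero_nat (𝕜 := ℝ) |>.const_add 1)
      simpa [Function.comp_def] using this
    · have : (1 : ℝ) / ((n : ℝ) + 1) ≠ 0 := by positivity
      simp only [mem_compl_iff, mem_singleton_iff]
      exact_mod_cast (by simpa using this)
  exact htend.frequently (Frequently.of_forall fun n => hreal _ (by positivity))

theorem mittagLeffler_term_eq {α : ℝ} (p w : ℂ) (k : ℕ) {t : ℝ} (ht : 0 < t) :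
    Complex.exp (-p * t) * ((w * ((t ^ α : ℝ) : ℂ)) ^ k / Complex.Gamma (α * k + (1 : ℝ))) =
      w ^ k / Complex.Gamma (α * k + (1 : ℝ)) *
        (((t ^ (α * k) : ℝ) : ℂ) * Complex.exp (-p * t)) := by
  rw [rpow_mul ht.le, rpow_natCast, mul_pow]
  push_cast
  ring

theorem integrableOn_mittagLeffler_term {α : ℝ} (hα : 0 < α) {p : ℂ} (hp : 0 < p.re) (w : ℂ)
    (k : ℕ) :
    IntegrableOn (fun t : ℝ => Complex.exp (-p * t) *
      ((w * ((t ^ α : ℝ) : ℂ)) ^ k / Complex.Gamma (α * k + (1 : ℝ)))) (Ioi 0) := by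
  have hk : (-1 : ℝ) < α * k := by
    have : 0 ≤ α * k := by positivity
    linarith
  exact IntegrableOn.congr_fun ((integrableOn_rpow_mul_cexp hk hp).const_mul _)
    (fun t ht => (mittagLeffler_term_eq p w k ht).symm) measurableSet_Ioi

theorem integral_mittagLeffler_term {α : ℝ} (hα : 0 < α) {p : ℂ} (hp : 0 < p.re) (w : ℂ) (k : ℕ) :
    ∫ t in Ioi (0 : ℝ), Complex.exp (-p * t) *
      ((w * ((t ^ α : ℝ) : ℂ)) ^ k / Complex.Gamma (α * k + (1 : ℝ))) =
      p⁻¹ * (w * (p ^ (α : ℂ))⁻¹) ^ k := by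
  have hk : (-1 : ℝ) < α * k := by
    have : 0 ≤ α * k := by positivity
    linarith
  have hp0 : p ≠ 0 := by
    rintro rfl
    simp at hp
  have hΓ : Complex.Gamma (α * k + (1 : ℝ)) ≠ 0 := by
    rw [Gamma_nat_mul_add_one]
    exact_mod_cast (Gamma_pos_of_pos (by linarith)).ne'
  rw [setIntegral_congr_fun measurableSet_Ioi fun t ht => mittagLeffler_term_eq p w k ht,
    integral_const_mul, integral_rpow_mul_cexp hk hp, Complex.cpow_add _ _ hp0, Complex.cpow_one]
  push_cast at hΓ ⊢
  rw [mul_comm (α : ℂ) k, Complex.cpow_nat_mul, mul_pow, mul_comm (k : ℂ)]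
  field_simp
  rw [div_pow, one_pow, mul_one_div]

theorem norm_lt_norm_cpow {α : ℝ} (hα : 0 < α) {p w : ℂ} (hp : 1 < p.re) (hw : ‖w‖ = 1) :
    ‖w‖ < ‖p ^ (α : ℂ)‖ := by
  rw [Complex.norm_cpow_real, hw]
  exact one_lt_rpow (hp.trans_le (Complex.re_le_norm p)) hα

/-- The Laplace transform of `t ↦ E_α(w t^α)`. -/
theorem integral_cexp_mul_mittagLeffler {α : ℝ} (hα : 0 < α) {p w : ℂ} (hp : 1 < p.re)
    (hw : ‖w‖ = 1) :
    ∫ t in Ioi (0 : ℝ), Complex.exp (-p * t) * mittagLeffler α 1 (w * ((t ^ α : ℝ) : ℂ)) =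
      p ^ (α : ℂ) / (p * (p ^ (α : ℂ) - w)) := by
  have hlt := norm_lt_norm_cpow hα hp hw
  have hp0 : p ≠ 0 := by
    rintro rfl
    norm_num at hp
  have hnorm : ∀ k : ℕ, ∫ t in Ioi (0 : ℝ), ‖Complex.exp (-p * t) *
      ((w * ((t ^ α : ℝ) : ℂ)) ^ k / Complex.Gamma (α * k + (1 : ℝ)))‖ =
      p.re⁻¹ * ((p.re ^ α)⁻¹) ^ k := by
    intro k
    have h := integral_mittagLeffler_term hα (p := p.re) (by simp; linarith) 1 k
    rw [← Complex.ofReal_inj, ← integral_complex_ofReal]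
    push_cast
    rw [Complex.ofReal_cpow (by linarith), ← one_mul ((p.re : ℂ) ^ (α : ℂ))⁻¹, ← h]
    refine setIntegral_congr_fun measurableSet_Ioi fun t ht => ?_
    have ht' : (0 : ℝ) < t := ht
    have hΓ : 0 < Gamma (α * k + 1) := Gamma_pos_of_pos (by positivity)
    have hG := Gamma_nat_mul_add_one (α := α) k
    simp only [Complex.ofReal_one] at hG ⊢
    rw [hG, norm_mul, norm_div, norm_pow, norm_mul, hw, Complex.norm_exp,
      Complex.norm_real, Complex.norm_real, norm_of_nonneg hΓ.le,
      norm_of_nonneg (by positivity : (0 : ℝ) ≤ t ^ α)]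
    push_cast
    simp
  have hS := hasSum_integral_of_summable_integral_norm
    (integrableOn_mittagLeffler_term hα (by linarith : 0 < p.re) w) (by
      simp_rw [hnorm]
      exact (summable_geometric_of_lt_one (by have := hp; positivity)
        (inv_lt_one_of_one_lt₀ (one_lt_rpow hp hα))).mul_left _)
  have h1 : ∀ t : ℝ, ∑' k : ℕ, Complex.exp (-p * t) *
      ((w * ((t ^ α : ℝ) : ℂ)) ^ k / Complex.Gamma (α * k + (1 : ℝ))) =
      Complex.exp (-p * t) * mittagLeffler α 1 (w * ((t ^ α : ℝ) : ℂ)) := fun t => by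
    rw [tsum_mul_left]
    rfl
  simp_rw [h1, integral_mittagLeffler_term hα (by linarith : 0 < p.re) w] at hS
  have hq : ‖w * (p ^ (α : ℂ))⁻¹‖ < 1 := by
    rw [norm_mul, norm_inv, ← div_eq_mul_inv, div_lt_one (lt_of_le_of_lt (norm_nonneg _) hlt)]
    exact hlt
  rw [← hS.tsum_eq, tsum_mul_left, tsum_geometric_of_norm_lt_one hq]
  have hpa : p ^ (α : ℂ) ≠ 0 := by simp [Complex.cpow_eq_zero_iff, hp0]
  have hpw : p ^ (α : ℂ) - w ≠ 0 := fun h => hlt.ne' (by rw [sub_eq_zero.1 h])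
  have hpw' : 1 - w * (p ^ (α : ℂ))⁻¹ ≠ 0 := fun h => hpw (by
    field_simp at h
    simpa using h)
  field_simp

theorem integrableOn_cexp_mul_mittagLeffler {α : ℝ} (hα : 0 < α) {p w : ℂ} (hp : 1 < p.re)
    (hw : ‖w‖ = 1) :
    IntegrableOn (fun t : ℝ => Complex.exp (-p * t) * mittagLeffler α 1 (w * ((t ^ α : ℝ) : ℂ)))
      (Ioi 0) := by
  have hlt := norm_lt_norm_cpow hα hp hw
  have hp0 : p ≠ 0 := by
    rintro rfl
    norm_num at hp
  refine Integrable.of_integral_ne_zero ?_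
  rw [integral_cexp_mul_mittagLeffler hα hp hw]
  have hpw : p ^ (α : ℂ) - w ≠ 0 := fun h => hlt.ne' (by rw [sub_eq_zero.1 h])
  simp [Complex.cpow_eq_zero_iff, hp0, hpw]

/-- The difference `E_α((it)^α) - e^{it} / α`, corrected by a decaying term that makes it vanish
at `t = 0`. -/
noncomputable def mittagLefflerRemainder (α t : ℝ) : ℂ :=
  mittagLeffler α 1 (Complex.I ^ (α : ℂ) * ((t ^ α : ℝ) : ℂ)) -
    1 / α * Complex.exp (Complex.I * t) - (1 - 1 / α) * Complex.exp (-t)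

/-- The analytic continuation of the Laplace transform of `mittagLefflerRemainder α`. -/
noncomputable def laplaceRemainder (α : ℝ) (p : ℂ) : ℂ :=
  p ^ (α : ℂ) / (p * (p ^ (α : ℂ) - Complex.I ^ (α : ℂ))) -
    1 / α / (p - Complex.I) - (1 - 1 / α) / (p + 1)

theorem norm_I_cpow (α : ℝ) : ‖Complex.I ^ (α : ℂ)‖ = 1 := by
  rw [Complex.norm_cpow_real]
  simp

theorem integrableOn_cexp_neg_mul {q : ℂ} (hq : 0 < q.re) :
    IntegrableOn (fun t : ℝ => Complex.exp (-q * t)) (Ioi 0) :=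
  integrableOn_exp_mul_complex_Ioi (by simpa using hq) 0

theorem integral_cexp_neg_mul {q : ℂ} (hq : 0 < q.re) :
    ∫ t in Ioi (0 : ℝ), Complex.exp (-q * t) = q⁻¹ := by
  rw [integral_exp_mul_complex_Ioi (by simpa using hq)]
  simp

theorem cexp_mul_mittagLefflerRemainder (α t : ℝ) (p : ℂ) :
    Complex.exp (-p * t) * mittagLefflerRemainder α t =
      Complex.exp (-p * t) * mittagLeffler α 1 (Complex.I ^ (α : ℂ) * ((t ^ α : ℝ) : ℂ)) -
      1 / α * Complex.exp (-(p - Complex.I) * t) -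
      (1 - 1 / α) * Complex.exp (-(p + 1) * t) := by
  rw [mittagLefflerRemainder, show -(p - Complex.I) * t = -p * t + Complex.I * t by ring,
    show -(p + 1) * t = -p * t + -t by ring, Complex.exp_add, Complex.exp_add]
  ring

theorem integrableOn_cexp_mul_mittagLefflerRemainder {α : ℝ} (hα : 0 < α) {p : ℂ}
    (hp : 1 < p.re) :
    IntegrableOn (fun t : ℝ => Complex.exp (-p * t) * mittagLefflerRemainder α t) (Ioi 0) := by
  simp_rw [cexp_mul_mittagLefflerRemainder]
  exact ((integrableOn_cexp_mul_mittagLeffler hα hp (norm_I_cpow α)).sub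
    ((integrableOn_cexp_neg_mul (by simp; linarith)).const_mul _)).sub
    ((integrableOn_cexp_neg_mul (by simp; linarith)).const_mul _)

theorem integral_cexp_mul_mittagLefflerRemainder {α : ℝ} (hα : 0 < α) {p : ℂ}
    (hp : 1 < p.re) :
    ∫ t in Ioi (0 : ℝ), Complex.exp (-p * t) * mittagLefflerRemainder α t =
      laplaceRemainder α p := by
  simp_rw [cexp_mul_mittagLefflerRemainder]
  have h1 : 0 < (p - Complex.I).re := by simp; linarith
  have h2 : 0 < (p + 1).re := by simp; linarith
  rw [integral_sub, integral_sub, integral_cexp_mul_mittagLeffler hα hp (norm_I_cpow α),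
    integral_const_mul, integral_const_mul, integral_cexp_neg_mul h1, integral_cexp_neg_mul h2]
  · rfl
  · exact integrableOn_cexp_mul_mittagLeffler hα hp (norm_I_cpow α)
  · exact (integrableOn_cexp_neg_mul h1).const_mul _
  · exact (integrableOn_cexp_mul_mittagLeffler hα hp (norm_I_cpow α)).sub
      ((integrableOn_cexp_neg_mul h1).const_mul _)
  · exact (integrableOn_cexp_neg_mul h2).const_mul _

/-- The radial majorant of `laplaceRemainder α` on the right half-plane. -/
noncomputable def radialBound (α x : ℝ) : ℝ := x ^ (α - 1) / (1 + x ^ (2 * α))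

theorem radialBound_anti {α : ℝ} (hα₀ : 0 < α) (hα₁ : α < 1) {x y : ℝ} (hx : 0 < x)
    (hxy : x ≤ y) : radialBound α y ≤ radialBound α x := by
  unfold radialBound
  have := rpow_le_rpow_of_nonpos hx hxy (by linarith : α - 1 ≤ 0)
  gcongr

theorem radialBound_pos (α : ℝ) {x : ℝ} (hx : 0 < x) : 0 < radialBound α x := by
  unfold radialBound
  positivity

theorem rpow_le_two_mul_radialBound {α : ℝ} (hα₀ : 0 < α) {x : ℝ} (hx : 0 < x) (hx1 : x ≤ 1) :
    x ^ (α - 1) ≤ 2 * radialBound α x := by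
  have : x ^ (2 * α) ≤ 1 := rpow_le_one hx.le hx1 (by positivity)
  rw [radialBound, ← mul_div_assoc, le_div_iff₀ (by positivity)]
  nlinarith [rpow_pos_of_pos hx (α - 1)]

theorem rpow_neg_le_two_mul_radialBound {α : ℝ} (hα₀ : 0 < α) {x : ℝ} (hx1 : 1 ≤ x) :
    x ^ (-1 - α) ≤ 2 * radialBound α x := by
  have hx : 0 < x := by linarith
  have h1 : 1 ≤ x ^ (2 * α) := one_le_rpow hx1 (by positivity)
  have h2 : x ^ (α - 1) = x ^ (-1 - α) * x ^ (2 * α) := by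
    rw [← rpow_add hx]
    ring_nf
  rw [radialBound, ← mul_div_assoc, le_div_iff₀ (by positivity), h2]
  nlinarith [rpow_pos_of_pos hx (-1 - α)]

theorem integrable_radialBound_abs {α : ℝ} (hα₀ : 0 < α) :
    Integrable fun y : ℝ => radialBound α |y| := by
  have hmeas : Measurable (radialBound α) := by
    unfold radialBound
    fun_prop
  have h1 : IntegrableOn (radialBound α) (Ioi 0) := by
    rw [← Ioc_union_Ioi_eq_Ioi zero_le_one]
    refine IntegrableOn.union ?_ ?_
    · have h := (intervalIntegrable_iff_integrableOn_Ioc_of_le zero_le_one).1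
        (intervalIntegral.intervalIntegrable_rpow' (by linarith : -1 < α - 1))
      refine Integrable.mono' h hmeas.aestronglyMeasurable ?_
      filter_upwards [ae_restrict_mem measurableSet_Ioc] with x hx
      have hx0 : 0 < x := hx.1
      rw [norm_of_nonneg (radialBound_pos α hx.1).le]
      exact div_le_self (by positivity) (by linarith [rpow_pos_of_pos hx0 (2 * α)])
    · refine Integrable.mono' (integrableOn_Ioi_rpow_of_lt (by linarith : -1 - α < -1) one_pos)
        hmeas.aestronglyMeasurable ?_
      filter_upwards [ae_restrict_mem measurableSet_Ioi] with x hx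
      have hx0 : 0 < x := one_pos.trans hx
      rw [norm_of_nonneg (radialBound_pos α hx0).le, radialBound, div_le_iff₀ (by positivity),
        mul_add, ← rpow_add hx0, show -1 - α + 2 * α = α - 1 by ring]
      linarith [rpow_pos_of_pos hx0 (-1 - α)]
  have h2 : IntegrableOn (fun y : ℝ => radialBound α |y|) (Ioi 0) :=
    h1.congr_fun (fun y hy => by rw [abs_of_pos hy]) measurableSet_Ioi
  have h3 : IntegrableOn (fun y : ℝ => radialBound α |y|) (Iic 0) := by
    have m : MeasurableEmbedding fun x : ℝ => -x := (Homeomorph.neg ℝ).measurableEmbedding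
    rw [← Measure.map_neg_eq_self (volume : Measure ℝ), m.integrableOn_map_iff]
    simpa [Function.comp_def, integrableOn_Ici_iff_integrableOn_Ioi] using h2
  rw [← integrableOn_univ, ← Iic_union_Ioi (a := (0 : ℝ))]
  exact h3.union h2

theorem eq_I_of_cpow_eq {α : ℝ} (hα₀ : 0 < α) (hα₁ : α < 1) {p : ℂ} (hp : p ≠ 0)
    (h : p ^ (α : ℂ) = Complex.I ^ (α : ℂ)) : p = Complex.I := by
  have hlog : ∀ q : ℂ, q ≠ 0 → Complex.log (q ^ (α : ℂ)) = Complex.log q * α := by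
    intro q hq
    rw [Complex.cpow_def_of_ne_zero hq, Complex.log_exp] <;>
      simp only [Complex.im_mul_ofReal, Complex.log_im] <;>
      nlinarith [Complex.neg_pi_lt_arg q, Complex.arg_le_pi q, pi_pos]
  have h2 := hlog p hp
  rw [h, hlog _ Complex.I_ne_zero] at h2
  have hα : (α : ℂ) ≠ 0 := by exact_mod_cast hα₀.ne'
  rw [← Complex.exp_log hp, ← mul_right_cancel₀ hα h2, Complex.exp_log Complex.I_ne_zero]

theorem add_one_ne_zero_of_mem_slitPlane {p : ℂ} (hp : p ∈ Complex.slitPlane) : p + 1 ≠ 0 := by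
  intro h
  rw [eq_neg_of_add_eq_zero_left h] at hp
  simp [Complex.mem_slitPlane_iff] at hp
  linarith

theorem differentiableAt_laplaceRemainder {α : ℝ} (hα₀ : 0 < α) (hα₁ : α < 1) {p : ℂ}
    (hp : p ∈ Complex.slitPlane) (hpI : p ≠ Complex.I) :
    DifferentiableAt ℂ (laplaceRemainder α) p := by
  have hp0 : p ≠ 0 := Complex.slitPlane_ne_zero hp
  have hpa : p ^ (α : ℂ) - Complex.I ^ (α : ℂ) ≠ 0 := fun h =>
    hpI (eq_I_of_cpow_eq hα₀ hα₁ hp0 (sub_eq_zero.1 h))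
  have hc : DifferentiableAt ℂ (fun p : ℂ => p ^ (α : ℂ)) p :=
    differentiableAt_id.cpow_const hp
  unfold laplaceRemainder
  refine ((hc.div (differentiableAt_id.mul (hc.sub_const _)) (mul_ne_zero hp0 hpa)).sub
    ((differentiableAt_const _).div (differentiableAt_id.sub_const _) (sub_ne_zero.2 hpI))).sub
    ((differentiableAt_const _).div (differentiableAt_id.add_const _)
      (add_one_ne_zero_of_mem_slitPlane hp))

theorem tendsto_sub_mul_laplaceRemainder {α : ℝ} (hα₀ : 0 < α) :
    Tendsto (fun z => (z - Complex.I) * laplaceRemainder α z) (𝓝[≠] Complex.I) (𝓝 0) := by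
  set l : ℂ := Complex.I ^ (α : ℂ) with hl
  have hl0 : l ≠ 0 := by
    rw [hl, Complex.cpow_ne_zero_iff_of_exponent_ne_zero (by exact_mod_cast hα₀.ne')]
    exact Complex.I_ne_zero
  have hα : (α : ℂ) ≠ 0 := by exact_mod_cast hα₀.ne'
  have hI : Complex.I ∈ Complex.slitPlane := by simp [Complex.mem_slitPlane_iff]
  have hd : HasDerivAt (fun z : ℂ => z ^ (α : ℂ)) (α * (l / Complex.I)) Complex.I := by
    have := (hasDerivAt_id Complex.I).cpow_const (c := (α : ℂ)) hI
    simpa [Complex.cpow_sub _ _ Complex.I_ne_zero, hl] using this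
  have hd0 : (α : ℂ) * (l / Complex.I) ≠ 0 := by simp [hα, hl0]
  have h1 := (hasDerivAt_iff_tendsto_slope.1 hd).inv₀ hd0
  have hid : Tendsto (fun z : ℂ => z) (𝓝[≠] Complex.I) (𝓝 Complex.I) := nhdsWithin_le_nhds
  have h2 : Tendsto (fun z : ℂ => z ^ (α : ℂ) / z) (𝓝[≠] Complex.I) (𝓝 (l / Complex.I)) :=
    (hd.continuousAt.tendsto.mono_left nhdsWithin_le_nhds).div hid Complex.I_ne_zero
  have h3 : Tendsto (fun z : ℂ => (z - Complex.I) * ((1 - 1 / α) / (z + 1))) (𝓝[≠] Complex.I)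
      (𝓝 ((Complex.I - Complex.I) * ((1 - 1 / α) / (Complex.I + 1)))) :=
    (hid.sub_const _).mul (tendsto_const_nhds.div (hid.add_const _)
      (add_one_ne_zero_of_mem_slitPlane hI))
  have h4 := ((h2.mul h1).sub_const (1 / (α : ℂ))).sub h3
  have h5 : l / Complex.I * (α * (l / Complex.I))⁻¹ - 1 / α -
      (Complex.I - Complex.I) * ((1 - 1 / α) / (Complex.I + 1)) = 0 := by
    have := Complex.I_ne_zero
    field_simp
    ring
  rw [h5] at h4
  refine h4.congr' ?_
  filter_upwards [self_mem_nhdsWithin] with z hz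
  have hz' : z - Complex.I ≠ 0 := sub_ne_zero.2 hz
  rw [laplaceRemainder, slope_def_field, inv_div, ← hl]
  field_simp

theorem tendsto_limUnder_laplaceRemainder {α : ℝ} (hα₀ : 0 < α) (hα₁ : α < 1) :
    Tendsto (laplaceRemainder α) (𝓝[≠] Complex.I)
      (𝓝 (limUnder (𝓝[≠] Complex.I) (laplaceRemainder α))) := by
  refine Complex.tendsto_limUnder_of_differentiable_on_punctured_nhds_of_isLittleO ?_ ?_
  · have hI : Complex.I ∈ Complex.slitPlane := by simp [Complex.mem_slitPlane_iff]
    filter_upwards [nhdsWithin_le_nhds (Complex.isOpen_slitPlane.mem_nhds hI),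
      self_mem_nhdsWithin] with z hz hzI
    exact differentiableAt_laplaceRemainder hα₀ hα₁ hz hzI
  · refine Asymptotics.isLittleO_of_tendsto' ?_ ?_
    · filter_upwards [self_mem_nhdsWithin] with z hz h
      exact absurd h (inv_ne_zero (sub_ne_zero.2 hz))
    · have h1 : Tendsto (fun z => (z - Complex.I) * laplaceRemainder α Complex.I)
          (𝓝[≠] Complex.I) (𝓝 ((Complex.I - Complex.I) * laplaceRemainder α Complex.I)) :=
        (((continuous_id.sub continuous_const).mul continuous_const).tendsto _).mono_left
          nhdsWithin_le_nhds
      have := (tendsto_sub_mul_laplaceRemainder hα₀).sub h1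
      simp only [sub_self, zero_mul] at this
      refine this.congr fun z => ?_
      rw [div_inv_eq_mul]
      ring

theorem exists_bound_laplaceRemainder_annulus {α : ℝ} (hα₀ : 0 < α) (hα₁ : α < 1) {δ R : ℝ}
    (hδ : 0 < δ) :
    ∃ C : ℝ, ∀ p : ℂ, 0 ≤ p.re → δ ≤ ‖p‖ → ‖p‖ ≤ R → ‖laplaceRemainder α p‖ ≤ C := by
  set L := limUnder (𝓝[≠] Complex.I) (laplaceRemainder α)
  set K : Set ℂ := Metric.closedBall 0 R ∩ ({p | 0 ≤ p.re} ∩ {p | δ ≤ ‖p‖})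
  have hK : IsCompact K := (isCompact_closedBall _ _).inter_right
    ((isClosed_le continuous_const Complex.continuous_re).inter
      (isClosed_le continuous_const continuous_norm))
  have hcont : ContinuousOn (Function.update (laplaceRemainder α) Complex.I L) K := by
    intro p hp
    refine ContinuousAt.continuousWithinAt ?_
    rcases eq_or_ne p Complex.I with rfl | hpI
    · exact continuousAt_update_same.2 (tendsto_limUnder_laplaceRemainder hα₀ hα₁)
    · rw [continuousAt_update_of_ne hpI]
      refine (differentiableAt_laplaceRemainder hα₀ hα₁ ?_ hpI).continuousAt
      rw [Complex.mem_slitPlane_iff]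
      by_contra! h
      have h0 : p = 0 := Complex.ext (le_antisymm h.1 hp.2.1) h.2
      have := hp.2.2
      simp [h0] at this
      linarith
  obtain ⟨C, hC⟩ := hK.exists_bound_of_continuousOn hcont
  refine ⟨max C ‖laplaceRemainder α Complex.I‖, fun p h1 h2 h3 => ?_⟩
  rcases eq_or_ne p Complex.I with rfl | hpI
  · exact le_max_right _ _
  · have := hC p ⟨by simpa using h3, h1, h2⟩
    rw [Function.update_of_ne hpI] at this
    exact this.trans (le_max_left _ _)

theorem exists_bound_laplaceRemainder {α : ℝ} (hα₀ : 0 < α) (hα₁ : α < 1) :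
    ∃ C : ℝ, 0 ≤ C ∧ ∀ p : ℂ, 0 < p.re → ‖laplaceRemainder α p‖ ≤ C * radialBound α ‖p‖ := by
  set R : ℝ := 2 ^ (1 / α) with hR
  have hRα : R ^ α = 2 := by
    rw [hR, ← rpow_mul (by norm_num), one_div_mul_cancel hα₀.ne', rpow_one]
  have hR2 : 2 ≤ R := by
    have : (2 : ℝ) ^ (1 : ℝ) ≤ 2 ^ (1 / α) :=
      rpow_le_rpow_of_exponent_le (by norm_num) (by rw [one_le_div hα₀]; exact hα₁.le)
    rwa [rpow_one] at this
  have hR0 : 0 < R := by linarith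
  obtain ⟨C₁, hC₁⟩ := exists_bound_laplaceRemainder_annulus hα₀ hα₁ (δ := R⁻¹) (R := R)
    (by positivity)
  set A : ℝ := 2 + 2 * ‖1 / (α : ℂ)‖ + 2 * ‖1 - 1 / (α : ℂ)‖ with hA
  have hA0 : 0 ≤ A := by positivity
  set B : ℝ := |C₁| / radialBound α R with hB
  have hB0 : 0 ≤ B := div_nonneg (abs_nonneg _) (radialBound_pos α hR0).le
  have hBR : B * radialBound α R = |C₁| := div_mul_cancel₀ _ (radialBound_pos α hR0).ne'
  refine ⟨2 * A + B, by positivity, fun p hp => ?_⟩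
  have hp0 : p ≠ 0 := by
    rintro rfl
    simp at hp
  have hx : 0 < ‖p‖ := norm_pos_iff.2 hp0
  have hb := radialBound_pos α hx
  have hp1 : p + 1 ≠ 0 := add_one_ne_zero_of_mem_slitPlane (.inl hp)
  have hpI : p - Complex.I ≠ 0 := by
    intro h
    rw [sub_eq_zero.1 h] at hp
    simp at hp
  have hpa : p ^ (α : ℂ) - Complex.I ^ (α : ℂ) ≠ 0 := fun h =>
    hpI (sub_eq_zero.2 (eq_I_of_cpow_eq hα₀ hα₁ hp0 (sub_eq_zero.1 h)))
  have hl := norm_I_cpow α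
  have hna : ‖p ^ (α : ℂ)‖ = ‖p‖ ^ α := Complex.norm_cpow_real _ _
  rcases lt_or_ge ‖p‖ R⁻¹ with hlt | hge
  · have hx1 : ‖p‖ ≤ 1 / 2 := hlt.le.trans (by rw [one_div]; gcongr)
    have hxa : ‖p‖ ^ α ≤ 1 / 2 := by
      calc ‖p‖ ^ α ≤ (R⁻¹) ^ α := by gcongr
        _ = 1 / 2 := by rw [inv_rpow hR0.le, hRα, one_div]
    have d1 : 1 / 2 ≤ ‖p ^ (α : ℂ) - Complex.I ^ (α : ℂ)‖ := by
      have := norm_sub_norm_le (Complex.I ^ (α : ℂ)) (p ^ (α : ℂ))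
      rw [norm_sub_rev] at this
      linarith
    have d2 : 1 / 2 ≤ ‖p - Complex.I‖ := by
      have := norm_sub_norm_le Complex.I p
      rw [norm_sub_rev, Complex.norm_I] at this
      linarith
    have d3 : 1 / 2 ≤ ‖p + 1‖ := by
      have := Complex.re_le_norm (p + 1)
      simp at this
      linarith
    have hone : 1 ≤ ‖p‖ ^ (α - 1) := one_le_rpow_of_pos_of_le_one_of_nonpos hx (by linarith)
      (by linarith)
    have t1 : ‖p ^ (α : ℂ) / (p * (p ^ (α : ℂ) - Complex.I ^ (α : ℂ)))‖ ≤ 2 * ‖p‖ ^ (α - 1) := by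
      rw [norm_div, norm_mul, hna, ← div_div, rpow_sub_one hx.ne', div_le_iff₀ (by linarith)]
      have : 0 ≤ ‖p‖ ^ α / ‖p‖ := by positivity
      nlinarith
    have t2 : ‖1 / (α : ℂ) / (p - Complex.I)‖ ≤ 2 * ‖1 / (α : ℂ)‖ * ‖p‖ ^ (α - 1) := by
      rw [norm_div, div_le_iff₀ (by linarith)]
      have : 1 ≤ 2 * (‖p‖ ^ (α - 1) * ‖p - Complex.I‖) := by nlinarith
      nlinarith [norm_nonneg (1 / (α : ℂ))]
    have t3 : ‖(1 - 1 / (α : ℂ)) / (p + 1)‖ ≤ 2 * ‖1 - 1 / (α : ℂ)‖ * ‖p‖ ^ (α - 1) := by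
      rw [norm_div, div_le_iff₀ (by linarith)]
      have : 1 ≤ 2 * (‖p‖ ^ (α - 1) * ‖p + 1‖) := by nlinarith
      nlinarith [norm_nonneg (1 - 1 / (α : ℂ))]
    calc ‖laplaceRemainder α p‖ ≤ A * ‖p‖ ^ (α - 1) := by
          rw [laplaceRemainder]
          refine (norm_sub_le _ _).trans ((add_le_add_left (norm_sub_le _ _) _).trans ?_)
          rw [hA]
          linarith
      _ ≤ A * (2 * radialBound α ‖p‖) := by
          gcongr
          exact rpow_le_two_mul_radialBound hα₀ hx (by linarith)
      _ ≤ _ := by nlinarith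
  rcases le_or_gt ‖p‖ R with hle | hgt
  · calc ‖laplaceRemainder α p‖ ≤ |C₁| := (hC₁ p hp.le hge hle).trans (le_abs_self _)
      _ = B * radialBound α R := hBR.symm
      _ ≤ B * radialBound α ‖p‖ := by
          gcongr
          exact radialBound_anti hα₀ hα₁ hx hle
      _ ≤ _ := by nlinarith
  · have hxa : 2 ≤ ‖p‖ ^ α := by
      rw [← hRα]
      gcongr
    have d1 : ‖p‖ ^ α / 2 ≤ ‖p ^ (α : ℂ) - Complex.I ^ (α : ℂ)‖ := by
      have := norm_sub_norm_le (p ^ (α : ℂ)) (Complex.I ^ (α : ℂ))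
      linarith
    have d2 : ‖p‖ / 2 ≤ ‖p - Complex.I‖ := by
      have := norm_sub_norm_le p Complex.I
      rw [Complex.norm_I] at this
      linarith
    have d3 : ‖p‖ / 2 ≤ ‖p + 1‖ := by
      have := norm_sub_norm_le p (-1)
      rw [norm_neg, norm_one, sub_neg_eq_add] at this
      linarith
    have hprod : ‖p‖ ^ (-1 - α) * (‖p‖ * ‖p‖ ^ α) = 1 := by
      rw [← rpow_one_add' hx.le (by linarith), ← rpow_add hx]
      simp
    have hxx : ‖p‖ ^ α ≤ ‖p‖ := by
      conv_rhs => rw [← rpow_one ‖p‖]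
      exact rpow_le_rpow_of_exponent_le (by linarith) hα₁.le
    have hy : 0 < ‖p‖ ^ (-1 - α) := by positivity
    have key : ∀ (c z : ℂ) (m : ℝ), ‖p‖ ^ α ≤ m → m / 2 ≤ ‖z‖ →
        ‖c / (p * z)‖ ≤ 2 * ‖c‖ * ‖p‖ ^ (-1 - α) := by
      intro c z m hm hz
      have hz' : ‖p‖ ^ α ≤ 2 * ‖z‖ := by linarith
      rw [norm_div, norm_mul, div_le_iff₀ (mul_pos hx (by linarith))]
      calc ‖c‖ = ‖c‖ * (‖p‖ ^ (-1 - α) * (‖p‖ * ‖p‖ ^ α)) := by rw [hprod, mul_one]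
        _ ≤ ‖c‖ * (‖p‖ ^ (-1 - α) * (‖p‖ * (2 * ‖z‖))) := by gcongr
        _ = _ := by ring
    have t1 := key (Complex.I ^ (α : ℂ)) _ _ le_rfl d1
    have t2 := key (1 / (α : ℂ) * Complex.I) _ _ hxx d2
    have t3 := key (1 - 1 / (α : ℂ)) _ _ hxx d3
    rw [hl, mul_one] at t1
    rw [norm_mul, Complex.norm_I, mul_one] at t2
    have hsplit : laplaceRemainder α p =
        Complex.I ^ (α : ℂ) / (p * (p ^ (α : ℂ) - Complex.I ^ (α : ℂ))) -
        1 / (α : ℂ) * Complex.I / (p * (p - Complex.I)) +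
        (1 - 1 / (α : ℂ)) / (p * (p + 1)) := by
      have hα : (α : ℂ) ≠ 0 := by exact_mod_cast hα₀.ne'
      rw [laplaceRemainder]
      generalize p ^ (α : ℂ) = u at *
      generalize Complex.I ^ (α : ℂ) = v at *
      field_simp
      ring
    calc ‖laplaceRemainder α p‖ ≤ A * ‖p‖ ^ (-1 - α) := by
          rw [hsplit]
          refine (norm_add_le _ _).trans ((add_le_add_left (norm_sub_le _ _) _).trans ?_)
          rw [hA]
          linarith
      _ ≤ A * (2 * radialBound α ‖p‖) := by
          gcongr
          exact rpow_neg_le_two_mul_radialBound hα₀ (by linarith)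
      _ ≤ _ := by nlinarith

theorem differentiableAt_cexp_mul_laplaceRemainder {α : ℝ} (hα₀ : 0 < α) (hα₁ : α < 1) (t : ℝ)
    {p : ℂ} (hp : 0 < p.re) :
    DifferentiableAt ℂ (fun p : ℂ => Complex.exp (p * t) * laplaceRemainder α p) p := by
  have hI : p ≠ Complex.I := by
    rintro rfl
    simp at hp
  exact (by fun_prop : DifferentiableAt ℂ (fun p : ℂ => Complex.exp (p * t)) p).mul
    (differentiableAt_laplaceRemainder hα₀ hα₁ (.inl hp) hI)

theorem continuous_cexp_mul_laplaceRemainder {α : ℝ} (hα₀ : 0 < α) (hα₁ : α < 1) (t : ℝ) {c : ℝ}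
    (hc : 0 < c) :
    Continuous fun y : ℝ => Complex.exp ((c + y * Complex.I) * t) *
      laplaceRemainder α (c + y * Complex.I) := by
  refine continuous_iff_continuousAt.2 fun y => ?_
  have h : 0 < ((c : ℂ) + y * Complex.I).re := by simpa using hc
  exact ContinuousAt.comp (f := fun y : ℝ => (c : ℂ) + y * Complex.I)
    (differentiableAt_cexp_mul_laplaceRemainder hα₀ hα₁ t h).continuousAt (by fun_prop)

theorem norm_cexp_mul_laplaceRemainder_le {α : ℝ} (hα₀ : 0 < α) (hα₁ : α < 1) {C : ℝ}
    (hC₀ : 0 ≤ C)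
    (hC : ∀ p : ℂ, 0 < p.re → ‖laplaceRemainder α p‖ ≤ C * radialBound α ‖p‖) (t : ℝ) {c y : ℝ}
    (hc : 0 < c) (hy : y ≠ 0) :
    ‖Complex.exp ((c + y * Complex.I) * t) * laplaceRemainder α (c + y * Complex.I)‖ ≤
      exp (c * t) * (C * radialBound α |y|) := by
  rw [norm_mul, Complex.norm_exp]
  have h1 : (((c : ℂ) + y * Complex.I) * t).re = c * t := by simp
  have h2 : |y| ≤ ‖(c : ℂ) + y * Complex.I‖ := by
    simpa using Complex.abs_im_le_norm ((c : ℂ) + y * Complex.I)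
  rw [h1]
  gcongr
  refine (hC _ (by simpa using hc)).trans ?_
  gcongr
  exact radialBound_anti hα₀ hα₁ (abs_pos.2 hy) h2

theorem integrable_cexp_mul_laplaceRemainder {α : ℝ} (hα₀ : 0 < α) (hα₁ : α < 1) (t : ℝ) {c : ℝ}
    (hc : 0 < c) :
    Integrable fun y : ℝ => Complex.exp ((c + y * Complex.I) * t) *
      laplaceRemainder α (c + y * Complex.I) := by
  obtain ⟨C, hC₀, hC⟩ := exists_bound_laplaceRemainder hα₀ hα₁
  refine Integrable.mono' (((integrable_radialBound_abs hα₀).const_mul C).const_mul (exp (c * t)))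
    (continuous_cexp_mul_laplaceRemainder hα₀ hα₁ t hc).aestronglyMeasurable ?_
  filter_upwards [compl_mem_ae_iff.2 (measure_singleton (0 : ℝ))] with y hy
  exact norm_cexp_mul_laplaceRemainder_le hα₀ hα₁ hC₀ hC t hc hy

theorem tendsto_radialBound_atTop {α : ℝ} (hα₁ : α < 1) :
    Tendsto (radialBound α) atTop (𝓝 0) := by
  have h : Tendsto (fun x : ℝ => x ^ (-(1 - α))) atTop (𝓝 0) :=
    tendsto_rpow_neg_atTop (by linarith)
  refine squeeze_zero' ?_ ?_ h
  · filter_upwards [eventually_gt_atTop 0] with x hx using (radialBound_pos α hx).le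
  · filter_upwards [eventually_gt_atTop 0] with x hx
    rw [neg_sub]
    exact div_le_self (by positivity) (by linarith [rpow_pos_of_pos hx (2 * α)])

theorem tendsto_integral_horizontal {α : ℝ} (hα₀ : 0 < α) (hα₁ : α < 1) (t : ℝ) {c d : ℝ}
    (hc : 0 < c) (hd : 0 < d) {s : ℝ} (hs : |s| = 1) :
    Tendsto (fun R : ℝ => ∫ x : ℝ in c..d, Complex.exp ((x + (s * R : ℝ) * Complex.I) * t) *
      laplaceRemainder α (x + (s * R : ℝ) * Complex.I)) atTop (𝓝 0) := by
  obtain ⟨C, hC₀, hC⟩ := exists_bound_laplaceRemainder hα₀ hα₁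
  have h := (((tendsto_radialBound_atTop hα₁).const_mul C).const_mul
    (exp (max c d * |t|))).mul_const |d - c|
  simp only [mul_zero, zero_mul] at h
  refine squeeze_zero_norm' ?_ h
  filter_upwards [eventually_gt_atTop 0] with R hR
  refine intervalIntegral.norm_integral_le_of_norm_le_const fun x hx => ?_
  have hx0 : 0 < x := (lt_min hc hd).trans hx.1
  have hsR : |s * R| = R := by rw [abs_mul, hs, one_mul, abs_of_pos hR]
  refine (norm_cexp_mul_laplaceRemainder_le hα₀ hα₁ hC₀ hC t hx0
    (abs_pos.1 (hsR.symm ▸ hR))).trans ?_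
  rw [hsR]
  have := radialBound_pos α hR
  have hxt : x * t ≤ max c d * |t| :=
    (mul_le_mul_of_nonneg_left (le_abs_self t) hx0.le).trans
      (mul_le_mul_of_nonneg_right hx.2 (abs_nonneg t))
  gcongr

/-- The inverse Laplace integral of `laplaceRemainder α` does not depend on the abscissa. -/
theorem integral_cexp_mul_laplaceRemainder_eq {α : ℝ} (hα₀ : 0 < α) (hα₁ : α < 1) (t : ℝ)
    {c d : ℝ} (hc : 0 < c) (hd : 0 < d) :
    ∫ y : ℝ, Complex.exp ((c + y * Complex.I) * t) * laplaceRemainder α (c + y * Complex.I) =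
      ∫ y : ℝ, Complex.exp ((d + y * Complex.I) * t) * laplaceRemainder α (d + y * Complex.I) := by
  have hvert : ∀ {e : ℝ}, 0 < e → Tendsto (fun R : ℝ => ∫ y : ℝ in (-R)..R,
      Complex.exp ((e + y * Complex.I) * t) * laplaceRemainder α (e + y * Complex.I)) atTop
      (𝓝 (∫ y : ℝ, Complex.exp ((e + y * Complex.I) * t) *
        laplaceRemainder α (e + y * Complex.I))) := fun he =>
    intervalIntegral_tendsto_integral (integrable_cexp_mul_laplaceRemainder hα₀ hα₁ t he)
      tendsto_neg_atTop_atBot tendsto_id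
  have hlim := (((tendsto_integral_horizontal hα₀ hα₁ t hc hd (s := -1) (by simp)).sub
    (tendsto_integral_horizontal hα₀ hα₁ t hc hd (s := 1) (by simp))).add
    ((hvert hd).const_smul Complex.I)).sub ((hvert hc).const_smul Complex.I)
  have hzero : ∀ R : ℝ, _ = (0 : ℂ) := fun R =>
    Complex.integral_boundary_rect_eq_zero_of_differentiableOn
      (fun p : ℂ => Complex.exp (p * t) * laplaceRemainder α p) ⟨c, -R⟩ ⟨d, R⟩ (fun p hp =>
        (differentiableAt_cexp_mul_laplaceRemainder hα₀ hα₁ t (by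
          have h1 : p.re ∈ uIcc c d := hp.1
          exact (lt_min hc hd).trans_le h1.1)).differentiableWithinAt)
  simp only [neg_mul, one_mul] at hlim
  have h0 := tendsto_nhds_unique hlim ((tendsto_congr hzero).2 tendsto_const_nhds)
  rw [sub_zero, zero_add, sub_eq_zero] at h0
  exact (smul_right_injective ℂ Complex.I_ne_zero h0).symm

/-- The Laplace inversion formula for `mittagLefflerRemainder α`. -/
theorem two_pi_mul_mittagLefflerRemainder_eq {α : ℝ} (hα₀ : 0 < α) (hα₁ : α < 1) {t : ℝ}
    (ht : 0 < t) :
    2 * π * mittagLefflerRemainder α t =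
      ∫ y : ℝ, Complex.exp (((2 : ℝ) + y * Complex.I) * t) *
        laplaceRemainder α ((2 : ℝ) + y * Complex.I) := by
  set F : ℝ → ℂ := (Ioi 0).indicator fun t =>
    Complex.exp (-(2 : ℝ) * t) * mittagLefflerRemainder α t with hF
  have hFint : Integrable F :=
    (integrable_indicator_iff measurableSet_Ioi).2
      (integrableOn_cexp_mul_mittagLefflerRemainder hα₀ (p := (2 : ℝ)) (by simp))
  have hfour : FourierTransform.fourier F = fun ξ : ℝ =>
      laplaceRemainder α ((2 : ℝ) + (2 * π * ξ : ℝ) * Complex.I) := by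
    ext ξ
    rw [Real.fourier_real_eq_integral_exp_smul, ← integral_cexp_mul_mittagLefflerRemainder hα₀
      (by simp), ← integral_indicator measurableSet_Ioi]
    refine integral_congr_ae (.of_forall fun s => ?_)
    simp only [hF, smul_eq_mul, indicator_apply, mul_ite, mul_zero]
    refine if_congr Iff.rfl ?_ rfl
    rw [← mul_assoc, ← Complex.exp_add]
    congr 2
    push_cast
    ring
  have hline := integrable_cexp_mul_laplaceRemainder hα₀ hα₁ 0 (c := 2) two_pos
  simp only [Complex.ofReal_zero, mul_zero, Complex.exp_zero, one_mul] at hline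
  have hFcont : ContinuousAt F t := by
    have h1 : ContinuousAt (fun t : ℝ =>
        Complex.exp (-(2 : ℝ) * t) * mittagLefflerRemainder α t) t := by
      have h2 : ContinuousAt (fun t : ℝ =>
          mittagLeffler α 1 (Complex.I ^ (α : ℂ) * ((t ^ α : ℝ) : ℂ))) t := by
        refine (continuous_mittagLeffler hα₀).continuousAt.comp ?_
        exact continuousAt_const.mul (Complex.continuous_ofReal.continuousAt.comp
          (continuousAt_rpow_const _ _ (.inl ht.ne')))
      unfold mittagLefflerRemainder
      fun_prop
    refine h1.congr ?_
    filter_upwards [Ioi_mem_nhds ht] with s hs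
    rw [hF, indicator_of_mem hs]
  have hinv := hFint.fourierInv_fourier_eq (by
    rw [hfour]
    exact hline.comp_mul_left' two_pi_pos.ne') hFcont
  rw [hfour, Real.fourierInv_eq', hF, indicator_of_mem (mem_Ioi.2 ht)] at hinv
  have hsub := Measure.integral_comp_mul_left (fun y : ℝ =>
    Complex.exp (((2 : ℝ) + y * Complex.I) * t) *
      laplaceRemainder α ((2 : ℝ) + y * Complex.I)) (2 * π)
  have h3 : mittagLefflerRemainder α t = ∫ ξ : ℝ,
      Complex.exp (((2 : ℝ) + (2 * π * ξ : ℝ) * Complex.I) * t) *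
      laplaceRemainder α ((2 : ℝ) + (2 * π * ξ : ℝ) * Complex.I) := by
    have h4 : mittagLefflerRemainder α t = Complex.exp ((2 : ℝ) * t) *
        (Complex.exp (-(2 : ℝ) * t) * mittagLefflerRemainder α t) := by
      rw [← mul_assoc, ← Complex.exp_add]
      simp
    rw [h4, ← hinv, ← integral_const_mul]
    refine integral_congr_ae (.of_forall fun ξ => ?_)
    simp only [smul_eq_mul]
    rw [← mul_assoc, ← Complex.exp_add]
    congr 2
    simp
    ring
  rw [h3, hsub, abs_of_pos (by positivity), Complex.real_smul, ← mul_assoc]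
  have hcancel : 2 * (π : ℂ) * (((2 * π)⁻¹ : ℝ) : ℂ) = 1 := by
    rw [← Complex.ofReal_ofNat, ← Complex.ofReal_mul, ← Complex.ofReal_mul,
      mul_inv_cancel₀ (by positivity), Complex.ofReal_one]
  rw [hcancel, one_mul]

theorem two_pi_mul_mittagLefflerRemainder_eq_integral_imaginary {α : ℝ} (hα₀ : 0 < α)
    (hα₁ : α < 1) {t : ℝ} (ht : 0 < t) :
    2 * π * mittagLefflerRemainder α t =
      ∫ y : ℝ, Complex.exp (y * Complex.I * t) * laplaceRemainder α (y * Complex.I) := by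
  obtain ⟨C, hC₀, hC⟩ := exists_bound_laplaceRemainder hα₀ hα₁
  have hlim : Tendsto (fun c : ℝ => ∫ y : ℝ, Complex.exp ((c + y * Complex.I) * t) *
      laplaceRemainder α (c + y * Complex.I)) (𝓝[>] 0)
      (𝓝 (∫ y : ℝ, Complex.exp (y * Complex.I * t) * laplaceRemainder α (y * Complex.I))) := by
    refine tendsto_integral_filter_of_dominated_convergence
      (fun y => exp (1 * t) * (C * radialBound α |y|)) ?_ ?_
      (((integrable_radialBound_abs hα₀).const_mul C).const_mul _) ?_
    · filter_upwards [self_mem_nhdsWithin] with c hc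
      exact (continuous_cexp_mul_laplaceRemainder hα₀ hα₁ t hc).aestronglyMeasurable
    · filter_upwards [Ioc_mem_nhdsGT one_pos] with c hc
      filter_upwards [compl_mem_ae_iff.2 (measure_singleton (0 : ℝ))] with y hy
      refine (norm_cexp_mul_laplaceRemainder_le hα₀ hα₁ hC₀ hC t hc.1 hy).trans ?_
      have := radialBound_pos α (abs_pos.2 hy)
      gcongr
      exact hc.2
    · filter_upwards [compl_mem_ae_iff.2 (measure_singleton (0 : ℝ)),
        compl_mem_ae_iff.2 (measure_singleton (1 : ℝ))] with y hy hy1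
      have hp : (y : ℂ) * Complex.I ∈ Complex.slitPlane := .inr (by simpa using hy)
      have hpI : (y : ℂ) * Complex.I ≠ Complex.I := fun h => hy1 (by
        simpa using congrArg Complex.im h)
      have hcont : ContinuousAt (fun p : ℂ => Complex.exp (p * t) * laplaceRemainder α p)
          (y * Complex.I) :=
        (by fun_prop : ContinuousAt (fun p : ℂ => Complex.exp (p * t)) _).mul
          (differentiableAt_laplaceRemainder hα₀ hα₁ hp hpI).continuousAt
      have hpath : Tendsto (fun c : ℝ => (c : ℂ) + y * Complex.I) (𝓝[>] 0)
          (𝓝 (y * Complex.I)) := by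
        have h : Continuous fun c : ℝ => (c : ℂ) + y * Complex.I := by fun_prop
        simpa using (h.tendsto 0).mono_left nhdsWithin_le_nhds
      exact hcont.tendsto.comp hpath
  refine tendsto_nhds_unique (tendsto_const_nhds.congr' ?_) hlim
  filter_upwards [self_mem_nhdsWithin] with c hc
  rw [two_pi_mul_mittagLefflerRemainder_eq hα₀ hα₁ ht]
  exact integral_cexp_mul_laplaceRemainder_eq hα₀ hα₁ t two_pos hc

theorem tendsto_mittagLefflerRemainder {α : ℝ} (hα₀ : 0 < α) (hα₁ : α < 1) :
    Tendsto (mittagLefflerRemainder α) atTop (𝓝 0) := by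
  have hRL := Real.tendsto_integral_exp_smul_cocompact
    fun y : ℝ => laplaceRemainder α (y * Complex.I)
  have harg : Tendsto (fun t : ℝ => -(t / (2 * π))) atTop (cocompact ℝ) :=
    (tendsto_neg_atTop_atBot.comp (tendsto_id.atTop_div_const two_pi_pos)).mono_right
      atBot_le_cocompact
  have h := (hRL.comp harg).const_mul (2 * π : ℂ)⁻¹
  rw [mul_zero] at h
  refine h.congr' ?_
  have hπ : (π : ℂ) ≠ 0 := by exact_mod_cast pi_ne_zero
  filter_upwards [eventually_gt_atTop 0] with t ht
  rw [inv_mul_eq_iff_eq_mul₀ (by simp [hπ]),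
    two_pi_mul_mittagLefflerRemainder_eq_integral_imaginary hα₀ hα₁ ht]
  refine integral_congr_ae (.of_forall fun y => ?_)
  simp only [Circle.smul_def, Real.fourierChar_apply, smul_eq_mul]
  congr 2
  push_cast
  field_simp

/-- For `0 < α < 1` and `r > 0`,
`E_α(r e^{iαπ/2} t^α) − (1/α) exp(i r^{1/α} t) → 0` as `t → ∞`. -/
theorem mittagLeffler_boundary_asymptotics (α : ℝ) (hα₀ : 0 < α) (hα₁ : α < 1)
    (r : ℝ) (hr : 0 < r) :
    Tendsto
      (fun t : ℝ =>
        mittagLeffler α 1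
            ((r : ℂ) * Complex.exp ((α * π / 2 : ℝ) * Complex.I) * ((t ^ α : ℝ) : ℂ)) -
          (1 / (α : ℂ)) * Complex.exp (Complex.I * ((r ^ (1 / α) : ℝ) : ℂ) * (t : ℂ)))
      atTop (nhds 0) := by
  have hs : Tendsto (fun t : ℝ => r ^ (1 / α) * t) atTop atTop :=
    tendsto_id.const_mul_atTop (by positivity)
  have hexp : Tendsto (fun s : ℝ => (1 - 1 / (α : ℂ)) * Complex.exp (-s)) atTop (𝓝 0) := by
    have h : Tendsto (fun s : ℝ => ((exp (-s) : ℝ) : ℂ)) atTop (𝓝 ((0 : ℝ) : ℂ)) :=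
      (Complex.continuous_ofReal.tendsto _).comp tendsto_exp_neg_atTop_nhds_zero
    simpa using h.const_mul (1 - 1 / (α : ℂ))
  have h := (((tendsto_mittagLefflerRemainder hα₀ hα₁).add hexp).comp hs)
  rw [add_zero] at h
  refine h.congr' ?_
  filter_upwards [eventually_gt_atTop 0] with t ht
  have hpow : (r ^ (1 / α) * t) ^ α = r * t ^ α := by
    rw [mul_rpow (by positivity) ht.le, ← rpow_mul hr.le, one_div_mul_cancel hα₀.ne', rpow_one]
  have hI : Complex.I ^ (α : ℂ) = Complex.exp ((α * π / 2 : ℝ) * Complex.I) := by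
    rw [Complex.cpow_def_of_ne_zero Complex.I_ne_zero, Complex.log_I]
    congr 1
    push_cast
    ring
  simp only [Function.comp_apply, mittagLefflerRemainder, sub_add_cancel]
  rw [hpow, hI]
  push_cast
  congr 2
  · ring_nf
  · ring_nf
end

section
/- Let 0 < α ≤ 1. Then the function f(x) = E_α(−x) is completely monotonic on (0,∞): f possesses derivatives of all orders on (0,∞) and (−1)^n f^{(n)}(x) ≥ 0 for every n ≥ 0 and every x > 0. -/
/-- The real one-parameter Mittag-Leffler function
`E_α(z) = ∑_{k=0}^∞ z^k / Γ(αk + 1)` for real `z`. -/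
noncomputable def mittagLefflerReal (α : ℝ) (z : ℝ) : ℝ :=
  ∑' k : ℕ, z ^ k / Real.Gamma (α * k + 1)

section ChineseRestaurant

/-- Expectation of `φ (K - 1)`, where `K` is the number of occupied tables in the Chinese
restaurant process with parameters `(α, 0)` after `n + 1` customers. -/
noncomputable def tableExpectation (α : ℝ) : ℕ → (ℕ → ℝ) → ℝ
  | 0, φ => φ 0
  | n + 1, φ => tableExpectation α n fun j =>
      φ j * (1 - α * (j + 1) / (n + 1)) + φ (j + 1) * (α * (j + 1) / (n + 1))

/-- The Euler product `∏_{i=1}^n (1 + s / i)`. -/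
noncomputable def eulerProd (s : ℝ) (n : ℕ) : ℝ :=
  ∏ i ∈ Finset.range n, (1 + s / (i + 1))

theorem tableExpectation_nonneg {α : ℝ} (hα₀ : 0 ≤ α) (hα₁ : α ≤ 1) (n : ℕ) {φ : ℕ → ℝ}
    (hφ : ∀ j, j ≤ n → 0 ≤ φ j) : 0 ≤ tableExpectation α n φ := by
  induction n generalizing φ with
  | zero => exact hφ 0 le_rfl
  | succ n ih =>
    refine ih fun j hj => ?_
    have hn : (0 : ℝ) < n + 1 := by positivity
    have hq : α * (j + 1) / (n + 1) ≤ 1 := by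
      rw [div_le_one hn]
      have : (j : ℝ) ≤ n := by exact_mod_cast hj
      nlinarith [(Nat.cast_nonneg j : (0 : ℝ) ≤ j)]
    exact add_nonneg (mul_nonneg (hφ j (by omega)) (by linarith))
      (mul_nonneg (hφ (j + 1) (by omega)) (by positivity))

theorem hasSum_tableExpectation (α : ℝ) (n : ℕ) {g : ℕ → ℕ → ℝ} {φ : ℕ → ℝ}
    (h : ∀ j, HasSum (fun k => g k j) (φ j)) :
    HasSum (fun k => tableExpectation α n (g k)) (tableExpectation α n φ) := by
  induction n generalizing g φ with
  | zero => exact h 0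
  | succ n ih => exact ih fun j => ((h j).mul_right _).add ((h (j + 1)).mul_right _)

theorem tableExpectation_const_mul (α c : ℝ) (n : ℕ) (φ : ℕ → ℝ) :
    tableExpectation α n (fun j => c * φ j) = c * tableExpectation α n φ := by
  induction n generalizing φ with
  | zero => rfl
  | succ n ih =>
    simp only [tableExpectation]
    rw [← ih]
    congr 1
    ext j
    ring

/-- The rising factorial moments of the number of tables. -/
theorem tableExpectation_factorial_div (α : ℝ) (n k : ℕ) :
    tableExpectation α n (fun j => ((j + k).factorial : ℝ) / j.factorial) =
      k.factorial * eulerProd (α * k) n := by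
  induction n with
  | zero => simp [tableExpectation, eulerProd]
  | succ n ih =>
    have hstep : (fun j : ℕ =>
        ((j + k).factorial : ℝ) / j.factorial * (1 - α * (j + 1) / (n + 1)) +
          ((j + 1 + k).factorial : ℝ) / (j + 1).factorial * (α * (j + 1) / (n + 1))) =
        fun j : ℕ => (1 + α * k / (n + 1)) * (((j + k).factorial : ℝ) / j.factorial) := by
      ext j
      have hj : (j.factorial : ℝ) ≠ 0 := by positivity
      have hj1 : (j + 1 : ℝ) ≠ 0 := by positivity
      have hn : (n + 1 : ℝ) ≠ 0 := by positivity
      rw [show j + 1 + k = j + k + 1 by ring, Nat.factorial_succ, Nat.factorial_succ]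
      push_cast
      field_simp
      ring
    rw [tableExpectation, hstep, tableExpectation_const_mul, ih, eulerProd, eulerProd,
      Finset.prod_range_succ]
    ring

theorem hasSum_pow_mul_factorial_div (j m : ℕ) {y : ℝ} (hy : |y| < 1) :
    HasSum (fun k : ℕ => y ^ k / k.factorial * (((j + (k + m)).factorial : ℝ) / j.factorial))
      (((j + m).factorial : ℝ) / j.factorial / (1 - y) ^ (j + m + 1)) := by
  have h := (hasSum_choose_mul_geometric_of_norm_lt_one (j + m)
    (r := y) (by simpa using hy)).mul_left (((j + m).factorial : ℝ) / j.factorial)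
  convert! h using 1
  · ext k
    rw [Nat.cast_choose ℝ (Nat.le_add_left (j + m) k), Nat.add_sub_cancel,
      show j + (k + m) = k + (j + m) by ring]
    field_simp
  · ring

theorem hasSum_eulerProd (α : ℝ) (n m : ℕ) {y : ℝ} (hy : |y| < 1) :
    HasSum (fun k : ℕ => y ^ k * (((k + m).factorial : ℝ) / k.factorial) *
        eulerProd (α * ↑(k + m)) n)
      (tableExpectation α n
        fun j => ((j + m).factorial : ℝ) / j.factorial / (1 - y) ^ (j + m + 1)) := by
  convert! hasSum_tableExpectation α n (fun j => hasSum_pow_mul_factorial_div j m hy) using 2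
    with k
  rw [tableExpectation_const_mul, tableExpectation_factorial_div]
  ring

theorem hasSum_eulerProd_div_rpow (α : ℝ) {n : ℕ} (hn : 0 < n) (m : ℕ) {z : ℝ}
    (hz : |z| < (n : ℝ) ^ α) :
    HasSum (fun k : ℕ => z ^ k * (((k + m).factorial : ℝ) / k.factorial) *
        (eulerProd (α * ↑(k + m)) n / (n : ℝ) ^ (α * ↑(k + m))))
      ((tableExpectation α n fun j => ((j + m).factorial : ℝ) / j.factorial /
        (1 - z / (n : ℝ) ^ α) ^ (j + m + 1)) / ((n : ℝ) ^ α) ^ m) := by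
  have hpos : 0 < (n : ℝ) ^ α := Real.rpow_pos_of_pos (by exact_mod_cast hn) α
  have hy : |z / (n : ℝ) ^ α| < 1 := by
    rwa [abs_div, abs_of_pos hpos, div_lt_one hpos]
  convert! (hasSum_eulerProd α n m hy).div_const (((n : ℝ) ^ α) ^ m) using 2 with k
  rw [Real.rpow_mul_natCast n.cast_nonneg, pow_add, div_pow]
  field_simp

end ChineseRestaurant

section EulerProduct

open Filter Topology

theorem eulerProd_nonneg {s : ℝ} (hs : 0 ≤ s) (n : ℕ) : 0 ≤ eulerProd s n :=
  Finset.prod_nonneg fun i _ => by positivity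

theorem eulerProd_div_rpow_le {s : ℝ} (hs : 1 ≤ s) {N n : ℕ} (hN : 0 < N) (hNn : N ≤ n) :
    eulerProd s n / (n : ℝ) ^ s ≤ eulerProd s N / (N : ℝ) ^ s := by
  induction n, hNn using Nat.le_induction with
  | base => rfl
  | succ n hn ih =>
    refine le_trans ?_ ih
    have hn0 : (0 : ℝ) < n := by exact_mod_cast hN.trans_le hn
    have hbern : 1 + s / (n + 1) ≤ ((n + 1 : ℝ) / n) ^ s := by
      have h := one_add_mul_self_le_rpow_one_add (s := 1 / (n : ℝ)) (by
        have : 0 < 1 / (n : ℝ) := by positivity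
        linarith) hs
      rw [show (n + 1 : ℝ) / n = 1 + 1 / n by field_simp]
      refine le_trans ?_ h
      rw [mul_one_div]
      gcongr
      linarith
    have hpow : (0 : ℝ) < (n : ℝ) ^ s := Real.rpow_pos_of_pos hn0 s
    rw [Real.div_rpow (by positivity) hn0.le, le_div_iff₀ hpow] at hbern
    rw [eulerProd, Finset.prod_range_succ, ← eulerProd, Nat.cast_add_one,
      div_le_div_iff₀ (by positivity) hpow]
    calc eulerProd s n * (1 + s / (n + 1)) * (n : ℝ) ^ s
        = eulerProd s n * ((1 + s / (n + 1)) * (n : ℝ) ^ s) := by ring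
      _ ≤ _ := mul_le_mul_of_nonneg_left hbern (eulerProd_nonneg (by linarith) n)

theorem tendsto_eulerProd_div_rpow {s : ℝ} (hs : 0 ≤ s) :
    Tendsto (fun n : ℕ => eulerProd s n / (n : ℝ) ^ s) atTop
      (𝓝 (1 / Real.Gamma (s + 1))) := by
  have hG := (Real.GammaSeq_tendsto_Gamma (s + 1)).inv₀
    (Real.Gamma_pos_of_pos (by linarith)).ne'
  have hfrac : Tendsto (fun n : ℕ => (n : ℝ) / (n + (s + 1))) atTop (𝓝 1) :=
    tendsto_natCast_div_add_atTop (s + 1)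
  have h := hfrac.mul hG
  rw [one_mul, ← one_div] at h
  refine h.congr' ?_
  filter_upwards [eventually_gt_atTop 0] with n hn
  have hn0 : (0 : ℝ) < n := by exact_mod_cast hn
  have hprod : ∏ j ∈ Finset.range (n + 1), (s + 1 + j) =
      eulerProd s n * n.factorial * (n + (s + 1)) := by
    rw [Finset.prod_range_succ, eulerProd, ← Finset.prod_range_add_one_eq_factorial,
      Nat.cast_prod, ← Finset.prod_mul_distrib, add_comm (s + 1)]
    congr 1
    refine Finset.prod_congr rfl fun i _ => ?_
    have : (i + 1 : ℝ) ≠ 0 := by positivity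
    push_cast
    field_simp
    ring
  have hE : 0 < eulerProd s n := Finset.prod_pos fun i _ => by positivity
  have hpow : (0 : ℝ) < (n : ℝ) ^ s := Real.rpow_pos_of_pos hn0 s
  rw [Real.GammaSeq, hprod, Real.rpow_add_one hn0.ne']
  have : (n : ℝ) + (s + 1) ≠ 0 := by positivity
  field_simp

end EulerProduct

section MittagLeffler

open Filter Topology

/-- The termwise `m`-th derivative of the Mittag-Leffler series. -/
noncomputable def mittagLefflerDeriv (α : ℝ) (m : ℕ) (z : ℝ) : ℝ :=
  ∑' k : ℕ, z ^ k * (((k + m).factorial : ℝ) / k.factorial) *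
    (1 / Real.Gamma (α * ↑(k + m) + 1))

theorem exists_summable_bound {α : ℝ} (hα : 0 < α) (m : ℕ) (z : ℝ) :
    ∃ u : ℕ → ℝ, Summable u ∧ ∀ᶠ n : ℕ in atTop, ∀ k : ℕ,
      ‖z ^ k * (((k + m).factorial : ℝ) / k.factorial) *
        (eulerProd (α * ↑(k + m)) n / (n : ℝ) ^ (α * ↑(k + m)))‖ ≤ u k := by
  obtain ⟨N, hN, hzN⟩ : ∃ N : ℕ, 0 < N ∧ |z| < (N : ℝ) ^ α :=
    ((eventually_gt_atTop 0).and (((tendsto_rpow_atTop hα).comp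
      tendsto_natCast_atTop_atTop).eventually_gt_atTop |z|)).exists
  have hbdd : ∀ k : ℕ, ∃ C : ℝ, ∀ n : ℕ,
      eulerProd (α * ↑(k + m)) n / (n : ℝ) ^ (α * ↑(k + m)) ≤ C := fun k =>
    (tendsto_eulerProd_div_rpow (s := α * ↑(k + m)) (by positivity)).bddAbove_range.imp
      fun C hC n => hC ⟨n, rfl⟩
  choose C hC using hbdd
  have hsum := (hasSum_eulerProd_div_rpow α hN m (z := |z|) (by rwa [abs_abs])).summable
  refine ⟨fun k => |z| ^ k * (((k + m).factorial : ℝ) / k.factorial) *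
    if 1 ≤ α * ↑(k + m) then eulerProd (α * ↑(k + m)) N / (N : ℝ) ^ (α * ↑(k + m)) else C k,
    ?_, ?_⟩
  · have hlarge : ∀ᶠ k : ℕ in atTop, 1 ≤ α * ↑(k + m) :=
      ((tendsto_natCast_atTop_atTop.comp (tendsto_add_atTop_nat m)).const_mul_atTop
        hα).eventually_ge_atTop 1
    refine (summable_congr_atTop ?_).2 hsum
    filter_upwards [hlarge] with k hk
    rw [if_pos hk]
  · filter_upwards [eventually_ge_atTop N] with n hn k
    have hE := eulerProd_nonneg (s := α * ↑(k + m)) (by positivity) n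
    rw [norm_mul, norm_mul, norm_pow, Real.norm_eq_abs, Real.norm_of_nonneg (by positivity),
      Real.norm_of_nonneg (by positivity)]
    gcongr
    split_ifs with hk
    · exact eulerProd_div_rpow_le hk hN hn
    · exact hC k n

theorem summable_mittagLefflerDeriv {α : ℝ} (hα : 0 < α) (m : ℕ) (z : ℝ) :
    Summable fun k : ℕ => z ^ k * (((k + m).factorial : ℝ) / k.factorial) *
      (1 / Real.Gamma (α * ↑(k + m) + 1)) := by
  obtain ⟨u, hu, hbound⟩ := exists_summable_bound hα m z
  refine hu.of_norm_bounded fun k => ?_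
  exact le_of_tendsto
    ((tendsto_eulerProd_div_rpow (by positivity)).const_mul _).norm
    (hbound.mono fun n hn => hn k)

theorem mittagLefflerDeriv_nonneg {α : ℝ} (hα₀ : 0 < α) (hα₁ : α ≤ 1) (m : ℕ) {z : ℝ}
    (hz : z ≤ 0) : 0 ≤ mittagLefflerDeriv α m z := by
  obtain ⟨u, hu, hbound⟩ := exists_summable_bound hα₀ m z
  refine ge_of_tendsto (tendsto_tsum_of_dominated_convergence hu
    (fun k => (tendsto_eulerProd_div_rpow (by positivity)).const_mul _) hbound) ?_
  filter_upwards [eventually_gt_atTop 0, ((tendsto_rpow_atTop hα₀).comp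
    tendsto_natCast_atTop_atTop).eventually_gt_atTop |z|] with n hn hzn
  rw [(hasSum_eulerProd_div_rpow α hn m hzn).tsum_eq]
  have hy : 0 ≤ 1 - z / (n : ℝ) ^ α := by
    have : z / (n : ℝ) ^ α ≤ 0 := div_nonpos_of_nonpos_of_nonneg hz (by positivity)
    linarith
  exact div_nonneg (tableExpectation_nonneg hα₀.le hα₁ n fun j _ => by positivity)
    (by positivity)

theorem hasDerivAt_mittagLefflerDeriv {α : ℝ} (hα : 0 < α) (m : ℕ) (z : ℝ) :
    HasDerivAt (mittagLefflerDeriv α m) (mittagLefflerDeriv α (m + 1) z) z := by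
  set c : ℕ → ℝ := fun k => ((k + m).factorial : ℝ) / k.factorial *
    (1 / Real.Gamma (α * ↑(k + m) + 1)) with hc
  have hc_nonneg : ∀ k, 0 ≤ c k := fun k =>
    mul_nonneg (by positivity) (one_div_nonneg.2 (Real.Gamma_pos_of_pos (by positivity)).le)
  have hshift : ∀ (x : ℝ) (k : ℕ), ((k + 1 : ℕ) : ℝ) * x ^ (k + 1 - 1) * c (k + 1) =
      x ^ k * (((k + (m + 1)).factorial : ℝ) / k.factorial) *
        (1 / Real.Gamma (α * ↑(k + (m + 1)) + 1)) := by
    intro x k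
    simp only [hc]
    rw [show k + 1 + m = k + (m + 1) by ring, Nat.factorial_succ k, Nat.add_sub_cancel]
    push_cast
    field_simp
  have hsum' : ∀ x : ℝ, Summable fun k : ℕ => (k : ℝ) * x ^ (k - 1) * c k := fun x => by
    rw [← summable_nat_add_iff 1]
    simp only [hshift]
    exact summable_mittagLefflerDeriv hα (m + 1) x
  have hderiv := hasDerivAt_tsum_of_isPreconnected (𝕜 := ℝ) (F := ℝ)
    (g := fun k x => x ^ k * c k) (g' := fun k x => (k : ℝ) * x ^ (k - 1) * c k)
    (hsum' (|z| + 1)) Metric.isOpen_ball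
    (convex_ball (0 : ℝ) (|z| + 1)).isPreconnected
    (fun k x _ => (hasDerivAt_pow k x).mul_const (c k))
    (fun k x hx => by
      have hx' : |x| ≤ |z| + 1 := by simpa using (mem_ball_zero_iff.1 hx).le
      rw [norm_mul, norm_mul, norm_pow, Real.norm_natCast, Real.norm_of_nonneg (hc_nonneg k),
        Real.norm_eq_abs]
      have := hc_nonneg k
      gcongr)
    (y₀ := z) (y := z) (by simp)
    (by simpa only [hc, mul_assoc] using summable_mittagLefflerDeriv hα m z) (by simp)
  convert! hderiv using 1
  · ext x
    simp only [mittagLefflerDeriv, hc, mul_assoc]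
  · rw [(hsum' z).tsum_eq_zero_add]
    simp only [hshift, mittagLefflerDeriv]
    simp

theorem iteratedDeriv_mittagLefflerReal {α : ℝ} (hα : 0 < α) (m : ℕ) :
    iteratedDeriv m (mittagLefflerReal α) = mittagLefflerDeriv α m := by
  induction m with
  | zero =>
    ext z
    rw [iteratedDeriv_zero, mittagLefflerReal, mittagLefflerDeriv]
    refine tsum_congr fun k => ?_
    have : (k.factorial : ℝ) ≠ 0 := by positivity
    simp [div_self this, div_eq_mul_inv]
  | succ m ih =>
    rw [iteratedDeriv_succ, ih]
    exact funext fun z => (hasDerivAt_mittagLefflerDeriv hα m z).deriv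

theorem contDiff_mittagLefflerReal {α : ℝ} (hα : 0 < α) :
    ContDiff ℝ (⊤ : ℕ∞) (mittagLefflerReal α) :=
  contDiff_of_differentiable_iteratedDeriv fun m _ => by
    rw [iteratedDeriv_mittagLefflerReal hα]
    exact fun z => (hasDerivAt_mittagLefflerDeriv hα m z).differentiableAt

end MittagLeffler

/-- For `0 < α ≤ 1`, the function `f(x) = E_α(−x)` is completely monotonic on `(0,∞)`:
it has derivatives of all orders there and `(−1)^n f^{(n)}(x) ≥ 0` for all `n` and all
`x > 0`. -/
theorem mittagLeffler_completelyMonotonic (α : ℝ) (hα₀ : 0 < α) (hα₁ : α ≤ 1) :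
    ContDiffOn ℝ (⊤ : ℕ∞) (fun x : ℝ => mittagLefflerReal α (-x)) (Set.Ioi 0) ∧
      ∀ (n : ℕ) (x : ℝ), 0 < x →
        0 ≤ (-1 : ℝ) ^ n * iteratedDeriv n (fun x : ℝ => mittagLefflerReal α (-x)) x := by
  refine ⟨((contDiff_mittagLefflerReal hα₀).comp contDiff_neg).contDiffOn, fun n x hx => ?_⟩
  rw [iteratedDeriv_comp_neg, iteratedDeriv_mittagLefflerReal hα₀, smul_eq_mul, ← mul_assoc,
    ← mul_pow, neg_one_mul, neg_neg, one_pow, one_mul]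
  exact mittagLefflerDeriv_nonneg hα₀ hα₁ n (by linarith)
end

section
/- Let 0 < α < 1, λ ∈ ℂ and C₁, C₂ ∈ ℂ. Define x₂(t) = C₂ · E_α(λ t^α) and x₁(t) = C₁ · E_α(λ t^α) + C₂ · t^α · E_α^{(1)}(λ t^α), where E_α^{(1)}(y) denotes the derivative of E_α at y. Then x₁(0) = C₁, x₂(0) = C₂, and for every t > 0 the Caputo derivatives satisfy (₀^C D_t^α x₁)(t) = λ x₁(t) + x₂(t) and (₀^C D_t^α x₂)(t) = λ x₂(t). -/
open MeasureTheory intervalIntegral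

/-- The Caputo fractional derivative of order `α ∈ (0,1)` (lower terminal `0`):
`(₀^C D_t^α f)(t) = (1/Γ(1−α)) ∫₀^t (t−τ)^{−α} f′(τ) dτ`. -/
noncomputable def caputoDeriv (α : ℝ) (f : ℝ → ℂ) (t : ℝ) : ℂ :=
  (1 / Complex.Gamma (1 - α)) *
    ∫ τ in (0 : ℝ)..t, (((t - τ) ^ (-α) : ℝ) : ℂ) * deriv f τ

theorem rpow_le_exp_mul_Gamma {A x : ℝ} (hA : 0 ≤ A) (hx : 0 ≤ x) :
    A ^ x ≤ Real.exp A * Real.Gamma (x + 1) := by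
  have hconv := Real.GammaIntegral_convergent (s := x + 1) (by linarith)
  simp only [add_sub_cancel_right] at hconv
  have hsub : Set.Ioi A ⊆ Set.Ioi (0 : ℝ) := Set.Ioi_subset_Ioi hA
  have h₁ : ∫ s in Set.Ioi A, Real.exp (-s) * A ^ x ≤ Real.Gamma (x + 1) := by
    rw [Real.Gamma_eq_integral (by linarith)]
    simp only [add_sub_cancel_right]
    calc ∫ s in Set.Ioi A, Real.exp (-s) * A ^ x
        ≤ ∫ s in Set.Ioi A, Real.exp (-s) * s ^ x := by
          refine setIntegral_mono_on ((integrableOn_exp_neg_Ioi A).mul_const _)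
            (hconv.mono_set hsub) measurableSet_Ioi fun s hs => ?_
          have hs' : A ≤ s := le_of_lt hs
          gcongr
      _ ≤ ∫ s in Set.Ioi 0, Real.exp (-s) * s ^ x := by
          refine setIntegral_mono_set hconv ?_ hsub.eventuallyLE
          filter_upwards [ae_restrict_mem measurableSet_Ioi] with s hs
          have hs' : 0 < s := hs
          simp only [Pi.zero_apply]
          positivity
  rw [MeasureTheory.integral_mul_const, integral_exp_neg_Ioi] at h₁
  calc A ^ x = Real.exp A * (Real.exp (-A) * A ^ x) := by
        rw [← mul_assoc, ← Real.exp_add, add_neg_cancel, Real.exp_zero, one_mul]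
    _ ≤ _ := by gcongr

theorem summable_pow_div_Gamma {α : ℝ} (hα : 0 < α) {r : ℝ} (hr : 0 < r) :
    Summable fun k : ℕ => r ^ k / Real.Gamma (α * k + 1) := by
  set A : ℝ := (2 * r) ^ α⁻¹
  have hA : 0 < A := by positivity
  have hAα : A ^ α = 2 * r := Real.rpow_inv_rpow (by positivity) hα.ne'
  refine Summable.of_nonneg_of_le (fun k => ?_) (fun k => ?_)
    (summable_geometric_two.mul_left (Real.exp A))
  · have := Real.Gamma_pos_of_pos (s := α * k + 1) (by positivity)
    positivity
  · have hG := Real.Gamma_pos_of_pos (s := α * k + 1) (by positivity)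
    have h := rpow_le_exp_mul_Gamma hA.le (x := α * k) (by positivity)
    rw [Real.rpow_mul hA.le, hAα, Real.rpow_natCast, mul_pow] at h
    rw [div_le_iff₀ hG, one_div, inv_pow]
    calc r ^ k = (2 ^ k)⁻¹ * (2 ^ k * r ^ k) := by field_simp
      _ ≤ (2 ^ k)⁻¹ * (Real.exp A * Real.Gamma (α * k + 1)) := by gcongr
      _ = _ := by ring

/-- Coefficient sequences of at most geometric growth. -/
def GeomBounded (d : ℕ → ℂ) : Prop :=
  ∃ M R : ℝ, 0 < R ∧ ∀ k, ‖d k‖ ≤ M * R ^ k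

theorem GeomBounded.shift {d : ℕ → ℂ} (hd : GeomBounded d) :
    GeomBounded fun k => d (k + 1) := by
  obtain ⟨M, R, hR, h⟩ := hd
  exact ⟨M * R, R, hR, fun k => (h (k + 1)).trans_eq (by ring)⟩

theorem GeomBounded.const_mul_pow (C z : ℂ) : GeomBounded fun k => C * z ^ k := by
  refine ⟨‖C‖, ‖z‖ + 1, by positivity, fun k => ?_⟩
  rw [norm_mul, norm_pow]
  gcongr
  linarith

theorem GeomBounded.const_mul_pow_pred (C z : ℂ) : GeomBounded fun k => C * z ^ (k - 1) := by
  refine ⟨‖C‖, ‖z‖ + 1, by positivity, fun k => ?_⟩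
  rw [norm_mul, norm_pow]
  gcongr
  exact (pow_le_pow_left₀ (norm_nonneg z) (by linarith) _).trans
    (pow_le_pow_right₀ (by linarith [norm_nonneg z]) (Nat.sub_le k 1))

theorem GeomBounded.nat_mul {d : ℕ → ℂ} (hd : GeomBounded d) :
    GeomBounded fun k => k * d k := by
  obtain ⟨M, R, hR, h⟩ := hd
  refine ⟨M, 2 * R, by positivity, fun k => ?_⟩
  have hk : (k : ℝ) ≤ 2 ^ k := by exact_mod_cast Nat.lt_two_pow_self.le
  rw [norm_mul, Complex.norm_natCast, mul_pow, mul_left_comm]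
  exact mul_le_mul hk (h k) (norm_nonneg _) (by positivity)

theorem GeomBounded.add {d e : ℕ → ℂ} (hd : GeomBounded d) (he : GeomBounded e) :
    GeomBounded fun k => d k + e k := by
  obtain ⟨M, R, hR, h⟩ := hd
  obtain ⟨N, S, hS, h'⟩ := he
  have hM : 0 ≤ M := by simpa using (norm_nonneg _).trans (h 0)
  have hN : 0 ≤ N := by simpa using (norm_nonneg _).trans (h' 0)
  refine ⟨M + N, R + S, by positivity, fun k => (norm_add_le _ _).trans ?_⟩
  rw [add_mul]
  refine add_le_add ((h k).trans ?_) ((h' k).trans ?_) <;> gcongr <;> linarith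

theorem GeomBounded.summable_norm {d : ℕ → ℂ} (hd : GeomBounded d) {α : ℝ} (hα : 0 < α)
    {r : ℝ} (hr : 0 ≤ r) :
    Summable fun k : ℕ => ‖d k‖ / Real.Gamma (α * k + 1) * r ^ k := by
  obtain ⟨M, R, hR, h⟩ := hd
  refine Summable.of_nonneg_of_le (fun k => ?_) (fun k => ?_)
    ((summable_pow_div_Gamma hα (r := R * (r + 1)) (by positivity)).mul_left M)
  · have := Real.Gamma_pos_of_pos (s := α * k + 1) (by positivity)
    positivity
  · have := Real.Gamma_pos_of_pos (s := α * k + 1) (by positivity)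
    have hM : 0 ≤ M := by simpa using (norm_nonneg _).trans (h 0)
    calc ‖d k‖ / Real.Gamma (α * k + 1) * r ^ k
        ≤ M * R ^ k / Real.Gamma (α * k + 1) * (r + 1) ^ k := by
          gcongr
          · exact h k
          · linarith
      _ = _ := by rw [mul_pow]; ring

theorem GeomBounded.summable {d : ℕ → ℂ} (hd : GeomBounded d) {α : ℝ} (hα : 0 < α) (z : ℂ) :
    Summable fun k : ℕ => d k / (Real.Gamma (α * k + 1) : ℂ) * z ^ k := by
  refine Summable.of_norm ((hd.summable_norm hα (norm_nonneg z)).congr fun k => ?_)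
  have := Real.Gamma_pos_of_pos (s := α * k + 1) (by positivity)
  rw [norm_mul, norm_div, norm_pow, Complex.norm_of_nonneg this.le]

/-- Termwise differentiation of a power series with Mittag-Leffler type coefficients. -/
theorem GeomBounded.hasDerivAt {d : ℕ → ℂ} (hd : GeomBounded d) {α : ℝ} (hα : 0 < α) (z : ℂ) :
    HasDerivAt (fun w : ℂ => ∑' k : ℕ, d k / (Real.Gamma (α * k + 1) : ℂ) * w ^ k)
      (∑' k : ℕ, d k / (Real.Gamma (α * k + 1) : ℂ) * (k * z ^ (k - 1))) z := by
  have hr : 1 ≤ ‖z‖ + 1 := by linarith [norm_nonneg z]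
  refine hasDerivAt_tsum_of_isPreconnected
    (hd.nat_mul.summable_norm hα (zero_le_one.trans hr))
    Metric.isOpen_ball (convex_ball (0 : ℂ) (‖z‖ + 1)).isPreconnected
    (fun k y _ => (hasDerivAt_pow k y).const_mul _) (fun k y hy => ?_)
    (Metric.mem_ball_self (zero_lt_one.trans_le hr)) (hd.summable hα 0) (by simp)
  have := Real.Gamma_pos_of_pos (s := α * k + 1) (by positivity)
  have hy' : ‖y‖ ≤ ‖z‖ + 1 := by simpa using (Metric.mem_ball.1 hy).le
  have hp : ‖y‖ ^ (k - 1) ≤ (‖z‖ + 1) ^ k :=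
    (pow_le_pow_left₀ (norm_nonneg y) hy' _).trans (pow_le_pow_right₀ hr (Nat.sub_le k 1))
  simp only [norm_mul, norm_div, norm_pow, Complex.norm_of_nonneg this.le, Complex.norm_natCast]
  calc ‖d k‖ / Real.Gamma (α * k + 1) * (k * ‖y‖ ^ (k - 1))
      ≤ ‖d k‖ / Real.Gamma (α * k + 1) * (k * (‖z‖ + 1) ^ k) := by gcongr
    _ = _ := by ring

theorem integral_sub_rpow_mul_rpow {p q t : ℝ} (hp : 0 < p) (hq : 0 < q) (ht : 0 < t) :
    ∫ τ in (0 : ℝ)..t, (t - τ) ^ (q - 1) * τ ^ (p - 1) =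
      t ^ (p + q - 1) * (Real.Gamma p * Real.Gamma q / Real.Gamma (p + q)) := by
  have h := Complex.betaIntegral_scaled p q ht
  rw [Complex.betaIntegral_eq_Gamma_mul_div _ _ (by simpa) (by simpa)] at h
  apply Complex.ofReal_injective
  rw [← intervalIntegral.integral_ofReal]
  push_cast [Complex.ofReal_cpow ht.le, ← Complex.Gamma_ofReal]
  rw [← h]
  refine intervalIntegral.integral_congr_Ioo_of_le ht.le fun τ hτ => ?_
  have h₁ : 0 ≤ t - τ := by linarith [hτ.2]
  push_cast [Complex.ofReal_cpow hτ.1.le, Complex.ofReal_cpow h₁]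
  ring

theorem intervalIntegrable_sub_rpow_mul_rpow {p q t : ℝ} (hp : 0 < p) (hq : 0 < q) (ht : 0 < t) :
    IntervalIntegrable (fun τ => (t - τ) ^ (q - 1) * τ ^ (p - 1)) volume 0 t := by
  by_contra h
  have h' := integral_sub_rpow_mul_rpow hp hq ht
  rw [intervalIntegral.integral_undef h] at h'
  have := Real.Gamma_pos_of_pos hp
  have := Real.Gamma_pos_of_pos hq
  have := Real.Gamma_pos_of_pos (add_pos hp hq)
  exact absurd h' (by positivity)

theorem GeomBounded.hasDerivAt_comp_rpow {d : ℕ → ℂ} (hd : GeomBounded d) {α : ℝ} (hα : 0 < α)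
    {τ : ℝ} (hτ : 0 < τ) :
    HasDerivAt
      (fun t : ℝ => ∑' k : ℕ, d k / (Real.Gamma (α * k + 1) : ℂ) * ((t ^ α : ℝ) : ℂ) ^ k)
      (∑' k : ℕ, d (k + 1) / (Real.Gamma (α * (k + 1)) : ℂ) *
        ((τ ^ (α * (k + 1) - 1) : ℝ) : ℂ)) τ := by
  have h₁ := (hd.hasDerivAt hα ((τ ^ α : ℝ) : ℂ)).comp τ
    (Real.hasDerivAt_rpow_const (p := α) (Or.inl hτ.ne')).ofReal_comp
  refine h₁.congr_deriv ?_
  have hs : Summable fun k : ℕ =>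
      d k / (Real.Gamma (α * k + 1) : ℂ) * (k * ((τ ^ α : ℝ) : ℂ) ^ (k - 1)) := by
    rw [← summable_mul_right_iff (a := ((τ ^ α : ℝ) : ℂ))
      (by exact_mod_cast (Real.rpow_pos_of_pos hτ α).ne')]
    refine (hd.nat_mul.summable hα ((τ ^ α : ℝ) : ℂ)).congr fun k => ?_
    rcases k with _ | k
    · simp
    · simp only [Nat.add_sub_cancel, pow_succ]; ring
  rw [hs.tsum_eq_zero_add]
  simp only [Nat.cast_zero, zero_mul, mul_zero, zero_add, Nat.add_sub_cancel]
  rw [← tsum_mul_right]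
  refine tsum_congr fun k => ?_
  have hp : 0 < α * (k + 1) := by positivity
  have hG := (Real.Gamma_pos_of_pos hp).ne'
  have hpow : τ ^ (α * (k + 1) - 1) = (τ ^ α) ^ k * τ ^ (α - 1) := by
    rw [← Real.rpow_natCast, ← Real.rpow_mul hτ.le, ← Real.rpow_add hτ]
    congr 1; ring
  push_cast
  rw [Real.Gamma_add_one hp.ne', hpow]
  have hG' : (Real.Gamma (α * (k + 1)) : ℂ) ≠ 0 := by exact_mod_cast hG
  have hα' : (α : ℂ) ≠ 0 := by exact_mod_cast hα.ne'
  have hk : (k : ℂ) + 1 ≠ 0 := by exact_mod_cast k.succ_ne_zero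
  push_cast
  field_simp

/-- The Caputo derivative of a series `∑ dₖ t^{αk} / Γ(αk + 1)` is obtained by shifting its
coefficient sequence. -/
theorem GeomBounded.caputoDeriv_eq {d : ℕ → ℂ} (hd : GeomBounded d) {α : ℝ} (hα₀ : 0 < α)
    (hα₁ : α < 1) {t : ℝ} (ht : 0 < t) :
    caputoDeriv α
      (fun t : ℝ => ∑' k : ℕ, d k / (Real.Gamma (α * k + 1) : ℂ) * ((t ^ α : ℝ) : ℂ) ^ k) t =
      ∑' k : ℕ, d (k + 1) / (Real.Gamma (α * k + 1) : ℂ) * ((t ^ α : ℝ) : ℂ) ^ k := by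
  have hq : 0 < 1 - α := by linarith
  have hp (k : ℕ) : 0 < α * (k + 1) := by positivity
  have hΓq := Real.Gamma_pos_of_pos hq
  have hΓ (k : ℕ) : 0 < Real.Gamma (α * k + 1) := Real.Gamma_pos_of_pos (by positivity)
  have hΓp (k : ℕ) := Real.Gamma_pos_of_pos (hp k)
  have hbeta (k : ℕ) : ∫ τ in Set.Ioc 0 t, (t - τ) ^ (-α) * τ ^ (α * (k + 1) - 1) =
      (t ^ α) ^ k * (Real.Gamma (α * (k + 1)) * Real.Gamma (1 - α) / Real.Gamma (α * k + 1)) := by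
    have h := integral_sub_rpow_mul_rpow (hp k) hq ht
    rw [intervalIntegral.integral_of_le ht.le, show 1 - α - 1 = -α by ring,
      show α * (k + 1) + (1 - α) = α * k + 1 by ring, add_sub_cancel_right,
      Real.rpow_mul ht.le, Real.rpow_natCast] at h
    exact h
  have hint (k : ℕ) : IntegrableOn (fun τ => (t - τ) ^ (-α) * τ ^ (α * (k + 1) - 1))
      (Set.Ioc 0 t) := by
    have h := intervalIntegrable_sub_rpow_mul_rpow (hp k) hq ht
    rw [intervalIntegrable_iff_integrableOn_Ioc_of_le ht.le, show 1 - α - 1 = -α by ring] at h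
    exact h
  set F : ℕ → ℝ → ℂ := fun k τ => d (k + 1) / (Real.Gamma (α * (k + 1)) : ℂ) *
    (((t - τ) ^ (-α) * τ ^ (α * (k + 1) - 1) : ℝ) : ℂ)
  have hFint (k : ℕ) : IntegrableOn (F k) (Set.Ioc 0 t) := (hint k).ofReal.const_mul _
  have hFnorm (k : ℕ) : ∫ τ in Set.Ioc 0 t, ‖F k τ‖ =
      Real.Gamma (1 - α) * (‖d (k + 1)‖ / Real.Gamma (α * k + 1) * (t ^ α) ^ k) := by
    have h : Set.EqOn (fun τ => ‖F k τ‖) (fun τ => ‖d (k + 1)‖ / Real.Gamma (α * (k + 1)) *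
        ((t - τ) ^ (-α) * τ ^ (α * (k + 1) - 1))) (Set.Ioc 0 t) := fun τ hτ => by
      have h₁ : 0 ≤ t - τ := by linarith [hτ.2]
      have h₂ : 0 ≤ τ := hτ.1.le
      simp only [F, norm_mul, norm_div]
      rw [Complex.norm_of_nonneg (hΓp k).le, Complex.norm_of_nonneg (by positivity)]
    rw [setIntegral_congr_fun measurableSet_Ioc h, MeasureTheory.integral_const_mul, hbeta]
    have := (hΓp k).ne'
    field_simp
  have hFval (k : ℕ) : ∫ τ in Set.Ioc 0 t, F k τ = (Real.Gamma (1 - α) : ℂ) *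
      (d (k + 1) / (Real.Gamma (α * k + 1) : ℂ) * ((t ^ α : ℝ) : ℂ) ^ k) := by
    simp only [F]
    rw [MeasureTheory.integral_const_mul, integral_complex_ofReal, hbeta]
    have : (Real.Gamma (α * (k + 1)) : ℂ) ≠ 0 := by exact_mod_cast (hΓp k).ne'
    push_cast
    field_simp
  have hsum := hasSum_integral_of_summable_integral_norm hFint
    (((hd.shift.summable_norm hα₀ (Real.rpow_nonneg ht.le α)).mul_left
      (Real.Gamma (1 - α))).congr fun k => (hFnorm k).symm)
  have hderiv : Set.EqOn (fun τ => (((t - τ) ^ (-α) : ℝ) : ℂ) * deriv (fun t : ℝ =>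
      ∑' k : ℕ, d k / (Real.Gamma (α * k + 1) : ℂ) * ((t ^ α : ℝ) : ℂ) ^ k) τ)
      (fun τ => ∑' k, F k τ) (Set.Ioc 0 t) := fun τ hτ => by
    simp only [F]
    rw [(hd.hasDerivAt_comp_rpow hα₀ hτ.1).deriv, ← tsum_mul_left]
    refine tsum_congr fun k => ?_
    push_cast
    ring
  rw [caputoDeriv, intervalIntegral.integral_of_le ht.le,
    setIntegral_congr_fun measurableSet_Ioc hderiv, ← hsum.tsum_eq, tsum_congr hFval,
    tsum_mul_left, ← mul_assoc, ← Complex.ofReal_one, ← Complex.ofReal_sub, Complex.Gamma_ofReal,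
    Complex.ofReal_one, one_div_mul_cancel (by exact_mod_cast hΓq.ne'), one_mul]

theorem mittagLeffler_one_eq_tsum (α : ℝ) (z : ℂ) :
    mittagLeffler α 1 z =
      ∑' k : ℕ, (1 * 1 ^ k : ℂ) / (Real.Gamma (α * k + 1) : ℂ) * z ^ k := by
  refine tsum_congr fun k => ?_
  rw [← Complex.Gamma_ofReal]
  push_cast
  ring

theorem deriv_mittagLeffler_one {α : ℝ} (hα : 0 < α) (z : ℂ) :
    deriv (mittagLeffler α 1) z =
      ∑' k : ℕ, (1 : ℂ) / (Real.Gamma (α * k + 1) : ℂ) * (k * z ^ (k - 1)) := by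
  rw [funext (mittagLeffler_one_eq_tsum α),
    ((GeomBounded.const_mul_pow 1 1).hasDerivAt hα z).deriv]
  simp

/-- For `0 < α < 1`, `λ ∈ ℂ`, the functions `x₂(t) = C₂ E_α(λt^α)` and
`x₁(t) = C₁ E_α(λt^α) + C₂ t^α E_α^{(1)}(λt^α)` (where `E_α^{(1)}` is the derivative
of `E_α`) satisfy `x₁(0) = C₁`, `x₂(0) = C₂`, and for every `t > 0`
`(₀^C D_t^α x₁)(t) = λ x₁(t) + x₂(t)` and `(₀^C D_t^α x₂)(t) = λ x₂(t)`. -/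
theorem caputo_jordan_block_solution (α : ℝ) (hα₀ : 0 < α) (hα₁ : α < 1)
    (lam C₁ C₂ : ℂ) (x₁ x₂ : ℝ → ℂ)
    (hx₂ : ∀ t : ℝ, x₂ t = C₂ * mittagLeffler α 1 (lam * ((t ^ α : ℝ) : ℂ)))
    (hx₁ : ∀ t : ℝ, x₁ t =
      C₁ * mittagLeffler α 1 (lam * ((t ^ α : ℝ) : ℂ)) +
        C₂ * ((t ^ α : ℝ) : ℂ) * deriv (mittagLeffler α 1) (lam * ((t ^ α : ℝ) : ℂ))) :
    x₁ 0 = C₁ ∧ x₂ 0 = C₂ ∧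
      ∀ t : ℝ, 0 < t →
        caputoDeriv α x₁ t = lam * x₁ t + x₂ t ∧
          caputoDeriv α x₂ t = lam * x₂ t := by
  set d₂ : ℕ → ℂ := fun k => C₂ * lam ^ k with hd₂
  set d₁ : ℕ → ℂ := fun k => C₁ * lam ^ k + k * (C₂ * lam ^ (k - 1)) with hd₁
  have hb₂ : GeomBounded d₂ := .const_mul_pow C₂ lam
  have hbC₁ := GeomBounded.const_mul_pow C₁ lam
  have hbC₂ := (GeomBounded.const_mul_pow_pred C₂ lam).nat_mul
  have hb₁ : GeomBounded d₁ := hbC₁.add hbC₂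
  have hx₂' : x₂ = fun t : ℝ =>
      ∑' k : ℕ, d₂ k / (Real.Gamma (α * k + 1) : ℂ) * ((t ^ α : ℝ) : ℂ) ^ k := by
    funext t
    rw [hx₂, mittagLeffler_one_eq_tsum, ← tsum_mul_left]
    refine tsum_congr fun k => ?_
    simp only [hd₂, mul_pow]
    ring
  have hx₁' : x₁ = fun t : ℝ =>
      ∑' k : ℕ, d₁ k / (Real.Gamma (α * k + 1) : ℂ) * ((t ^ α : ℝ) : ℂ) ^ k := by
    funext t
    simp only [hd₁, add_div, add_mul]
    rw [hx₁, mittagLeffler_one_eq_tsum, deriv_mittagLeffler_one hα₀,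
      (hbC₁.summable hα₀ _).tsum_add (hbC₂.summable hα₀ _), ← tsum_mul_left, ← tsum_mul_left]
    congr 1 <;> refine tsum_congr fun k => ?_
    · rw [mul_pow]
      ring
    · rcases k with _ | k
      · simp
      · simp only [Nat.add_sub_cancel, mul_pow, pow_succ]
        ring
  have hinit (d : ℕ → ℂ) :
      ∑' k : ℕ, d k / (Real.Gamma (α * k + 1) : ℂ) * (((0 : ℝ) ^ α : ℝ) : ℂ) ^ k = d 0 := by
    rw [tsum_eq_single 0 fun k hk => by simp [Real.zero_rpow hα₀.ne', hk]]
    simp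
  refine ⟨by rw [hx₁']; simpa [hd₁] using hinit d₁, by rw [hx₂']; simpa [hd₂] using hinit d₂,
    fun t ht => ⟨?_, ?_⟩⟩
  · rw [hx₁', hb₁.caputoDeriv_eq hα₀ hα₁ ht, hx₂', ← tsum_mul_left,
      ← ((hb₁.summable hα₀ _).mul_left lam).tsum_add (hb₂.summable hα₀ _)]
    refine tsum_congr fun k => ?_
    rcases k with _ | k
    · simp only [hd₁, hd₂]; push_cast; ring
    · simp only [hd₁, hd₂, Nat.add_sub_cancel]; push_cast; ring
  · rw [hx₂', hb₂.caputoDeriv_eq hα₀ hα₁ ht, ← tsum_mul_left]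
    refine tsum_congr fun k => ?_
    simp only [hd₂]
    ring
end
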